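/- arXiv:1709.06185 — 6 statements merged into one kernel-verified Lean document; each statement's English description precedes it below -/
import Mathlib

section
/- Let E be a forest relation on a finite set V and let E' ⊆ E. Then 𝒜_E(E') = 𝒜_{E∖E'}(E'): the ancestry of E' computed with the edge set E equals the ancestry of E' computed with the edge set E ∖ E' obtained by deleting the edges of E'. -/
namespace ForestAncestry

/-- `E` is a forest relation: every vertex has at most one parent
(`(v, w) ∈ E` means `v` is a parent of `w`). -/
def isForest {V : Type} (E : Set (V × V)) : Prop :=
  ∀ w v v', (v, w) ∈ E → (v', w) ∈ E → v = v'

/-- The ancestry `𝒜_E(v)`: vertices having a directed path (possibly empty) to `v`. -/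
def ancestry {V : Type} (E : Set (V × V)) (v : V) : Set V :=
  {u | Relation.ReflTransGen (fun a b => (a, b) ∈ E) u v}

/-- The ancestry `𝒜_E(E')` of a set of edges: the union of the ancestries of their sources. -/
def ancestrySet {V : Type} (E : Set (V × V)) (E' : Set (V × V)) : Set V :=
  ⋃ e ∈ E', ancestry E e.1

theorem mem_ancestrySet {V : Type} {E E' : Set (V × V)} {u : V} :
    u ∈ ancestrySet E E' ↔
      ∃ e ∈ E', Relation.ReflTransGen (fun a b => (a, b) ∈ E) u e.1 := by
  simp [ancestrySet, ancestry]

theorem ancestrySet_mono {V : Type} {E F : Set (V × V)} (h : E ⊆ F) (E' : Set (V × V)) :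
    ancestrySet E E' ⊆ ancestrySet F E' := fun _ hu =>
  let ⟨e, he, hue⟩ := mem_ancestrySet.1 hu
  mem_ancestrySet.2 ⟨e, he, Relation.ReflTransGen.mono (fun _ _ hab => h hab) _ _ hue⟩

/-- for a forest relation `E` on a finite set `V` and `E' ⊆ E`, the ancestry
of `E'` computed with edge set `E` equals the ancestry of `E'` computed with `E \ E'`. -/
theorem ancestry_delete {V : Type} [Fintype V] (E E' : Set (V × V))
    (hF : isForest E) (hsub : E' ⊆ E) :
    ancestrySet E E' = ancestrySet (E \ E') E' := by
  refine Set.Subset.antisymm (fun u hu => ?_) (ancestrySet_mono Set.sdiff_subset E')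
  obtain ⟨e, he, hue⟩ := mem_ancestrySet.1 hu
  induction hue using Relation.ReflTransGen.head_induction_on with
  | refl => exact mem_ancestrySet.2 ⟨e, he, .refl⟩
  | @head a b hab hbe ih =>
    by_cases hE' : (a, b) ∈ E'
    · exact mem_ancestrySet.2 ⟨(a, b), hE', .refl⟩
    · obtain ⟨f, hf, hbf⟩ := mem_ancestrySet.1 (ih (mem_ancestrySet.2 ⟨e, he, hbe⟩))
      exact mem_ancestrySet.2 ⟨f, hf, .head ⟨hab, hE'⟩ hbf⟩

end ForestAncestry
end

section
/- Let E be a forest relation on a finite set V and let E' ⊆ V × V with E ∩ E' = ∅ be such that E ∪ E' is again a forest relation. Then 𝒜_E(E') = 𝒜_{E∪E'}(E'): the ancestry of E' computed with the edge set E equals the ancestry of E' computed with the edge set E ∪ E' obtained by inserting the edges of E'. -/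
namespace ForestAncestry

/-- for a forest relation `E` on a finite set `V` and a set of new edges
`E' ⊆ V × V` disjoint from `E` such that `E ∪ E'` is again a forest relation, the ancestry
of `E'` computed with edge set `E` equals the ancestry of `E'` computed with `E ∪ E'`. -/
theorem ancestry_insert {V : Type} [Fintype V] (E E' : Set (V × V))
    (hF : isForest E) (hdisj : E ∩ E' = ∅) (hF' : isForest (E ∪ E')) :
    ancestrySet E E' = ancestrySet (E ∪ E') E' := by
  ext u
  simp only [ancestrySet, ancestry, Set.mem_iUnion, Set.mem_ofPred_eq, exists_prop]
  constructor
  · rintro ⟨e, he, h⟩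
    exact ⟨e, he, Relation.ReflTransGen.mono (fun _ _ hab => Or.inl hab) _ _ h⟩
  · rintro ⟨e, he, h⟩
    induction h using Relation.ReflTransGen.head_induction_on with
    | refl => exact ⟨e, he, .refl⟩
    | head hac _ ih =>
      rcases hac with hac | hac
      · obtain ⟨e', he', h'⟩ := ih
        exact ⟨e', he', h'.head hac⟩
      · exact ⟨_, hac, .refl⟩

end ForestAncestry
end

section
/- Let E be a forest relation on a finite set V, let E' ⊆ E, and let v ∈ V be a vertex with v ∉ 𝒜_E(E'). Then the set of vertices reachable from v by a directed path is the same before and after deleting the edges of E': for every x ∈ V, there is a directed path from v to x using edges of E if and only if there is one using only edges of E ∖ E'. -/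
namespace ForestAncestry

/-- let `E` be a forest relation on a finite set `V`, `E' ⊆ E`, and
`v ∉ 𝒜_E(E')`. Then the vertices reachable from `v` by a directed path are the same before
and after deleting the edges of `E'`. -/
theorem reachable_unchanged {V : Type} [Fintype V] (E E' : Set (V × V))
    (hF : isForest E) (hsub : E' ⊆ E) (v : V) (hv : v ∉ ancestrySet E E') :
    ∀ x : V, Relation.ReflTransGen (fun a b => (a, b) ∈ E) v x ↔
      Relation.ReflTransGen (fun a b => (a, b) ∈ E \ E') v x := by
  refine fun x => ⟨fun h => ?_, fun h =>
    Relation.ReflTransGen.mono (fun _ _ (hab : _ ∈ E \ E') => hab.1) v x h⟩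
  induction h with
  | refl => exact .refl
  | tail hvb hbc ih =>
    exact ih.tail ⟨hbc, fun hbc' => hv (Set.mem_biUnion hbc' hvb)⟩

end ForestAncestry
end

section
/- For any hybrid circuit C, valuation ν of C, and ∪-gate g of C: ⟦g⟧_ν = ⋃_{g' ∈ D^ν_g} ⟦g'⟧_ν, and ⟦g'⟧_ν ≠ ∅ for every g' ∈ D^ν_g. If moreover C is deterministic, then this union is disjoint: for all distinct g', g'' ∈ D^ν_g, the sets ⟦g'⟧_ν and ⟦g''⟧_ν are disjoint. -/
namespace MSOEnum

inductive GateType : Type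
  | svar | bvar | union | prod | box | band | bor | bnot
  deriving DecidableEq

def GateType.isBoolean : GateType → Prop
  | .bvar => True
  | .band => True
  | .bor => True
  | .bnot => True
  | _ => False

/-- A hybrid circuit: a finite DAG of gates, where `wire g g'` means that `g`
is an input of `g'`, with an output gate and gate types satisfying the
structural requirements of hybrid circuits. -/
structure HybridCircuit (α : Type) where
  gates : Finset α
  wire : α → α → Prop
  wire_mem : ∀ a b, wire a b → a ∈ gates ∧ b ∈ gates
  acyclic : WellFounded wire
  τ : α → GateType
  out : α
  out_mem : out ∈ gates
  out_setValued : ¬ (τ out).isBoolean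
  var_no_input : ∀ g, (τ g = GateType.svar ∨ τ g = GateType.bvar) → ∀ g', ¬ wire g' g
  boolGate_inputs : ∀ g, (τ g = GateType.band ∨ τ g = GateType.bor ∨ τ g = GateType.bnot) →
    ∀ g', wire g' g → (τ g').isBoolean
  bnot_input : ∀ g ∈ gates, τ g = GateType.bnot → ∃! g', wire g' g
  setGate_inputs : ∀ g, (τ g = GateType.union ∨ τ g = GateType.prod) →
    ∀ g', wire g' g → ¬ (τ g').isBoolean
  prod_inputs : ∀ g ∈ gates, τ g = GateType.prod →
    (∀ g', ¬ wire g' g) ∨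
    ∃ g₁ g₂, g₁ ≠ g₂ ∧ wire g₁ g ∧ wire g₂ g ∧ ∀ g', wire g' g → g' = g₁ ∨ g' = g₂
  box_inputs : ∀ g ∈ gates, τ g = GateType.box →
    ∃ gs gb, ¬ (τ gs).isBoolean ∧ (τ gb).isBoolean ∧ wire gs g ∧ wire gb g ∧
      ∀ g', wire g' g → g' = gs ∨ g' = gb

variable {α : Type}

open Classical in
/-- The Boolean value `⟨g⟩_ν` captured by each (Boolean) gate, computed bottom-up. -/
noncomputable def bval (C : HybridCircuit α) (ν : α → Bool) : α → Bool :=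
  C.acyclic.fix fun g rec =>
    match C.τ g with
    | .bvar => ν g
    | .band => decide (∀ g' (h : C.wire g' g), rec g' h = true)
    | .bor => decide (∃ g', ∃ h : C.wire g' g, rec g' h = true)
    | .bnot => decide (∀ g' (h : C.wire g' g), rec g' h = false)
    | _ => false

open Classical in
/-- The set `⟦g⟧_ν` of assignments captured by each (set-valued) gate, computed bottom-up. -/
noncomputable def sval (C : HybridCircuit α) (ν : α → Bool) : α → Set (Set α) :=
  C.acyclic.fix fun g rec =>
    match C.τ g with
    | .svar => {{g}}
    | .union => {a | ∃ g', ∃ h : C.wire g' g, a ∈ rec g' h}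
    | .prod =>
        if ∀ g', ¬ C.wire g' g then {∅}
        else {a | ∃ g₁ g₂, ∃ (h₁ : C.wire g₁ g) (h₂ : C.wire g₂ g), g₁ ≠ g₂ ∧
          ∃ a₁ ∈ rec g₁ h₁, ∃ a₂ ∈ rec g₂ h₂, a = a₁ ∪ a₂}
    | .box => {a | (∃ g', ∃ h : C.wire g' g, ¬ (C.τ g').isBoolean ∧ a ∈ rec g' h) ∧
        ∀ g'', C.wire g'' g → (C.τ g'').isBoolean → bval C ν g'' = true}
    | _ => (∅ : Set (Set α))

open Classical in
/-- The partial evaluation `ω_ν`. -/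
noncomputable def omegaEval (C : HybridCircuit α) (ν : α → Bool) (g : α) : Bool :=
  if (C.τ g).isBoolean then bval C ν g else decide (sval C ν g).Nonempty

def boxStep (C : HybridCircuit α) (a b : α) : Prop := C.wire a b ∧ C.τ b = GateType.box

/-- A ⊠-path from `g'` to `g` that is live under `ν`. -/
def liveBoxPath (C : HybridCircuit α) (ν : α → Bool) (g' g : α) : Prop :=
  ∃ g'', Relation.ReflTransGen (boxStep C) g' g'' ∧ C.wire g'' g ∧ omegaEval C ν g'' = true

/-- A ∪-path from `g'` to `g` that is live under `ν`. -/
def liveUnionPath (C : HybridCircuit α) (ν : α → Bool) (g' g : α) : Prop :=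
  ∃ g'', Relation.ReflTransGen
      (fun a b => liveBoxPath C ν a b ∧ C.τ b = GateType.union) g' g'' ∧
    liveBoxPath C ν g'' g

def isExit (C : HybridCircuit α) (g : α) : Prop :=
  C.τ g = GateType.prod ∨ C.τ g = GateType.svar

/-- The set `D^ν_g` of exits having a live ∪-path to `g` under `ν`. -/
def exitsOf (C : HybridCircuit α) (ν : α → Bool) (g : α) : Set α :=
  {g' | isExit C g' ∧ liveUnionPath C ν g' g}

def deterministic (C : HybridCircuit α) : Prop :=
  ∀ (ν : α → Bool), ∀ g ∈ C.gates, C.τ g = GateType.union →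
    ∀ g₁ g₂, C.wire g₁ g → C.wire g₂ g → g₁ ≠ g₂ →
      Disjoint (sval C ν g₁) (sval C ν g₂)

def decomposable (C : HybridCircuit α) : Prop :=
  ∀ g ∈ C.gates, C.τ g = GateType.prod →
    ∀ g₁ g₂, C.wire g₁ g → C.wire g₂ g → g₁ ≠ g₂ →
      ∀ v, C.τ v = GateType.svar →
        ¬ (Relation.ReflTransGen C.wire v g₁ ∧ Relation.ReflTransGen C.wire v g₂)

def isDDNNF (C : HybridCircuit α) : Prop := decomposable C ∧ deterministic C

/-- The wire `(g, g')` (with `g` set-valued) is pure under `ν`. -/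
def pureWire (C : HybridCircuit α) (ν : α → Bool) (g g' : α) : Prop :=
  C.wire g g' ∧ ¬ (C.τ g).isBoolean ∧
    (C.τ g' = GateType.union ∨
     (C.τ g' = GateType.box ∧
       ∀ g'', C.wire g'' g' → (C.τ g'').isBoolean → bval C ν g'' = true) ∨
     (C.τ g' = GateType.prod ∧ ∃ g'', C.wire g'' g' ∧ g'' ≠ g ∧ (∅ : Set α) ∈ sval C ν g''))

def upwardsDeterministic (C : HybridCircuit α) : Prop :=
  ∀ (ν : α → Bool) (g g₁ g₂ : α), pureWire C ν g g₁ → pureWire C ν g g₂ → g₁ = g₂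

def homogenized (C : HybridCircuit α) : Prop :=
  ¬ ∃ (ν : α → Bool) (g : α), g ∈ C.gates ∧ ¬ (C.τ g).isBoolean ∧ (∅ : Set α) ∈ sval C ν g

noncomputable def fanIn (C : HybridCircuit α) (g : α) : ℕ := {g' | C.wire g' g}.ncard

noncomputable def maxFanIn (C : HybridCircuit α) : ℕ := C.gates.sup (fanIn C)

/-- `Δ(g)`: the gates to which `g` has a directed path. -/
def deltaSet (C : HybridCircuit α) (g : α) : Set α := {g' | Relation.ReflTransGen C.wire g g'}

/-- The dependency size `Δ(C)`. -/
noncomputable def depSize (C : HybridCircuit α) : ℕ :=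
  C.gates.sup fun g => (deltaSet C g).ncard

end MSOEnum

namespace MSOEnum

variable {α : Type}

theorem sval_union (C : HybridCircuit α) (ν : α → Bool) {g : α} (hg : C.τ g = .union) :
    sval C ν g = {a | ∃ g', C.wire g' g ∧ a ∈ sval C ν g'} := by
  rw [sval, WellFounded.fix_eq]
  simp [hg]

theorem sval_box (C : HybridCircuit α) (ν : α → Bool) {g : α} (hg : C.τ g = .box) :
    sval C ν g = {a | (∃ g', C.wire g' g ∧ ¬ (C.τ g').isBoolean ∧ a ∈ sval C ν g') ∧
      ∀ g'', C.wire g'' g → (C.τ g'').isBoolean → bval C ν g'' = true} := by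
  rw [sval, WellFounded.fix_eq]
  simp [hg, and_left_comm]

theorem not_isBoolean_iff {t : GateType} :
    ¬ t.isBoolean ↔ t = .union ∨ t = .box ∨ t = .prod ∨ t = .svar := by
  cases t <;> simp [GateType.isBoolean]

theorem isExit.not_isBoolean {C : HybridCircuit α} {g : α} (hg : isExit C g) :
    ¬ (C.τ g).isBoolean :=
  not_isBoolean_iff.2 (.inr (.inr hg))

/-- A ⊠-gate has at most one set-valued input. -/
theorem box_input_unique (C : HybridCircuit α) {g a b : α} (hg : C.τ g = .box)
    (hag : C.wire a g) (hbg : C.wire b g) (ha : ¬ (C.τ a).isBoolean)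
    (hb : ¬ (C.τ b).isBoolean) : a = b := by
  obtain ⟨gs, gb, -, hgb, -, -, h⟩ := C.box_inputs g (C.wire_mem _ _ hag).2 hg
  have eq_gs : ∀ c, C.wire c g → ¬ (C.τ c).isBoolean → c = gs := fun c hcg hc =>
    (h c hcg).resolve_right fun e => hc (e ▸ hgb)
  rw [eq_gs a hag ha, eq_gs b hbg hb]

theorem not_isBoolean_of_boxPath {C : HybridCircuit α} {a b : α}
    (h : Relation.ReflTransGen (boxStep C) a b) (ha : ¬ (C.τ a).isBoolean) :
    ¬ (C.τ b).isBoolean := by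
  rcases h.cases_tail with rfl | ⟨c, -, -, hb⟩
  · exact ha
  · simp [hb, GateType.isBoolean]

/-- Along a path of ⊠-gates ending in a gate with a nonempty captured set, the captured set
does not change. -/
theorem sval_eq_of_boxPath {C : HybridCircuit α} {ν : α → Bool} {a b : α}
    (h : Relation.ReflTransGen (boxStep C) a b) (ha : ¬ (C.τ a).isBoolean)
    (hb : (sval C ν b).Nonempty) : sval C ν a = sval C ν b := by
  induction h with
  | refl => rfl
  | @tail b c hab hbc ih =>
    have hbB := not_isBoolean_of_boxPath hab ha
    have hcb : sval C ν b = sval C ν c := by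
      rw [sval_box C ν hbc.2] at hb ⊢
      obtain ⟨-, -, hall⟩ := hb
      ext x
      refine ⟨fun hx => ⟨⟨b, hbc.1, hbB, hx⟩, hall⟩, ?_⟩
      rintro ⟨⟨d, hdc, hd, hx⟩, -⟩
      rwa [box_input_unique C hbc.2 hbc.1 hdc hbB hd]
    rw [ih (hcb ▸ hb), hcb]

/-- The start of a ⊠-path is determined by its end, provided that it is not a ⊠-gate. -/
theorem boxPath_source_unique {C : HybridCircuit α} {a a' b : α}
    (h : Relation.ReflTransGen (boxStep C) a b) (h' : Relation.ReflTransGen (boxStep C) a' b)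
    (ha : ¬ (C.τ a).isBoolean) (ha' : ¬ (C.τ a').isBoolean)
    (hbox : C.τ a ≠ .box) (hbox' : C.τ a' ≠ .box) : a = a' := by
  induction h with
  | refl =>
    rcases h'.cases_tail with rfl | ⟨_, -, hc⟩
    · rfl
    · exact absurd hc.2 hbox
  | tail hab hbc ih =>
    rcases h'.cases_tail with rfl | ⟨d, hd, hdc⟩
    · exact absurd hbc.2 hbox'
    · obtain rfl := box_input_unique C hbc.2 hbc.1 hdc.1
        (not_isBoolean_of_boxPath hab ha) (not_isBoolean_of_boxPath hd ha')
      exact ih hd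

/-- Every assignment captured by a set-valued gate is captured by a gate that is not a ⊠-gate
and has a path of ⊠-gates to it. -/
theorem exists_boxPath_source (C : HybridCircuit α) (ν : α → Bool) {x : Set α} (b : α)
    (hb : ¬ (C.τ b).isBoolean) (hx : x ∈ sval C ν b) :
    ∃ a, Relation.ReflTransGen (boxStep C) a b ∧ (C.τ a = .union ∨ isExit C a) ∧
      x ∈ sval C ν a := by
  induction b using C.acyclic.induction with
  | _ b ih =>
    rcases not_isBoolean_iff.1 hb with h | h | h
    · exact ⟨b, .refl, .inl h, hx⟩
    · rw [sval_box C ν h] at hx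
      obtain ⟨⟨c, hcb, hc, hxc⟩, -⟩ := hx
      obtain ⟨a, hac, ha⟩ := ih c hcb hc hxc
      exact ⟨a, hac.tail ⟨hcb, h⟩, ha⟩
    · exact ⟨b, .refl, .inr h, hx⟩

theorem omegaEval_eq_true_iff {C : HybridCircuit α} {ν : α → Bool} {g : α}
    (hg : ¬ (C.τ g).isBoolean) : omegaEval C ν g = true ↔ (sval C ν g).Nonempty := by
  simp [omegaEval, hg]

theorem transGen_wire_of_liveBoxPath {C : HybridCircuit α} {ν : α → Bool} {a b : α}
    (h : liveBoxPath C ν a b) : Relation.TransGen C.wire a b := by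
  obtain ⟨c, hac, hcb, -⟩ := h
  exact .tail' (Relation.ReflTransGen.mono (fun _ _ h => h.1) _ _ hac) hcb

/-- A live ⊠-path passes through an input of its end that captures the same nonempty set as its
start. -/
theorem exists_input_of_liveBoxPath {C : HybridCircuit α} {ν : α → Bool} {a b : α}
    (h : liveBoxPath C ν a b) (ha : ¬ (C.τ a).isBoolean) :
    ∃ c, Relation.ReflTransGen (boxStep C) a c ∧ C.wire c b ∧ (sval C ν a).Nonempty ∧
      sval C ν a = sval C ν c := by
  obtain ⟨c, hac, hcb, hc⟩ := h
  have hne := (omegaEval_eq_true_iff (not_isBoolean_of_boxPath hac ha)).1 hc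
  have heq := sval_eq_of_boxPath hac ha hne
  exact ⟨c, hac, hcb, heq ▸ hne, heq⟩

theorem sval_subset_of_liveBoxPath {C : HybridCircuit α} {ν : α → Bool} {a b : α}
    (h : liveBoxPath C ν a b) (ha : ¬ (C.τ a).isBoolean) (hb : C.τ b = .union) :
    sval C ν a ⊆ sval C ν b := by
  obtain ⟨c, -, hcb, -, heq⟩ := exists_input_of_liveBoxPath h ha
  intro x hx
  rw [sval_union C ν hb]
  exact ⟨c, hcb, heq ▸ hx⟩

theorem sval_subset_of_unionSteps {C : HybridCircuit α} {ν : α → Bool} {a b : α}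
    (h : Relation.ReflTransGen (fun a b => liveBoxPath C ν a b ∧ C.τ b = .union) a b)
    (ha : ¬ (C.τ a).isBoolean) : ¬ (C.τ b).isBoolean ∧ sval C ν a ⊆ sval C ν b := by
  induction h with
  | refl => exact ⟨ha, subset_rfl⟩
  | tail _ hbc ih =>
    exact ⟨not_isBoolean_iff.2 (.inl hbc.2),
      ih.2.trans (sval_subset_of_liveBoxPath hbc.1 ih.1 hbc.2)⟩

theorem sval_subset_of_liveUnionPath {C : HybridCircuit α} {ν : α → Bool} {a b : α}
    (h : liveUnionPath C ν a b) (ha : ¬ (C.τ a).isBoolean) (hb : C.τ b = .union) :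
    sval C ν a ⊆ sval C ν b := by
  obtain ⟨c, hac, hcb⟩ := h
  obtain ⟨hc, hsub⟩ := sval_subset_of_unionSteps hac ha
  exact hsub.trans (sval_subset_of_liveBoxPath hcb hc hb)

theorem sval_nonempty_of_liveUnionPath {C : HybridCircuit α} {ν : α → Bool} {a b : α}
    (h : liveUnionPath C ν a b) (ha : ¬ (C.τ a).isBoolean) : (sval C ν a).Nonempty := by
  obtain ⟨c, hac, hcb⟩ := h
  rcases hac.cases_head with rfl | ⟨d, had, -⟩
  · exact (exists_input_of_liveBoxPath hcb ha).choose_spec.2.2.1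
  · exact (exists_input_of_liveBoxPath had.1 ha).choose_spec.2.2.1

theorem exists_exit_of_mem_sval (C : HybridCircuit α) (ν : α → Bool) {x : Set α} (g : α)
    (hg : C.τ g = .union) (hx : x ∈ sval C ν g) :
    ∃ e ∈ exitsOf C ν g, x ∈ sval C ν e := by
  induction g using C.acyclic.transGen.induction with
  | _ g ih =>
    rw [sval_union C ν hg] at hx
    obtain ⟨b, hbg, hxb⟩ := hx
    have hb := C.setGate_inputs g (.inl hg) b hbg
    obtain ⟨u, hub, hu, hxu⟩ := exists_boxPath_source C ν b hb hxb
    have hlive : liveBoxPath C ν u g := ⟨b, hub, hbg, (omegaEval_eq_true_iff hb).2 ⟨x, hxb⟩⟩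
    rcases hu with hu | hu
    · obtain ⟨e, ⟨he, v, hev, hvu⟩, hxe⟩ := ih u (transGen_wire_of_liveBoxPath hlive) hu hxu
      exact ⟨e, ⟨he, u, hev.tail ⟨hvu, hu⟩, hlive⟩, hxe⟩
    · exact ⟨u, ⟨hu, u, .refl, hlive⟩, hxu⟩

/-- A live ∪-path from an exit `e` to `g` ends with a live ⊠-path from either `e` itself or a
∪-gate of which `e` is an exit. -/
theorem exists_last_of_mem_exitsOf {C : HybridCircuit α} {ν : α → Bool} {e g : α}
    (h : e ∈ exitsOf C ν g) :
    ∃ u, liveBoxPath C ν u g ∧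
      (isExit C u ∧ e = u ∨ C.τ u = .union ∧ e ∈ exitsOf C ν u) := by
  obtain ⟨he, u, heu, hug⟩ := h
  refine ⟨u, hug, ?_⟩
  rcases heu.cases_tail with rfl | ⟨v, hev, hvu, hu⟩
  · exact .inl ⟨he, rfl⟩
  · exact .inr ⟨hu, he, v, hev, hvu⟩

theorem isExit.ne_union {C : HybridCircuit α} {g : α} (h : isExit C g) : C.τ g ≠ .union := by
  rcases h with h | h <;> simp [h]

theorem isExit.ne_box {C : HybridCircuit α} {g : α} (h : isExit C g) : C.τ g ≠ .box := by
  rcases h with h | h <;> simp [h]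

theorem exit_unique_of_deterministic {C : HybridCircuit α} (hC : deterministic C)
    (ν : α → Bool) {x : Set α} (g : α) (hg : C.τ g = .union) {e e' : α}
    (he : e ∈ exitsOf C ν g) (he' : e' ∈ exitsOf C ν g)
    (hx : x ∈ sval C ν e) (hx' : x ∈ sval C ν e') : e = e' := by
  induction g using C.acyclic.transGen.induction with
  | _ g ih =>
    have key : ∀ f ∈ exitsOf C ν g, x ∈ sval C ν f → ∃ u b, liveBoxPath C ν u g ∧
        (isExit C u ∧ f = u ∨ C.τ u = .union ∧ f ∈ exitsOf C ν u) ∧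
        ¬ (C.τ u).isBoolean ∧ C.τ u ≠ .box ∧
        Relation.ReflTransGen (boxStep C) u b ∧ C.wire b g ∧ x ∈ sval C ν b := by
      intro f hf hxf
      obtain ⟨u, hug, hu⟩ := exists_last_of_mem_exitsOf hf
      have hprops : ¬ (C.τ u).isBoolean ∧ C.τ u ≠ .box ∧ x ∈ sval C ν u := by
        rcases hu with ⟨hu, rfl⟩ | ⟨hu, hfu⟩
        · exact ⟨hu.not_isBoolean, hu.ne_box, hxf⟩
        · exact ⟨not_isBoolean_iff.2 (.inl hu), by simp [hu],
            sval_subset_of_liveUnionPath hfu.2 hfu.1.not_isBoolean hu hxf⟩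
      obtain ⟨huB, hubox, hxu⟩ := hprops
      obtain ⟨b, hub, hbg, -, heq⟩ := exists_input_of_liveBoxPath hug huB
      exact ⟨u, b, hug, hu, huB, hubox, hub, hbg, heq ▸ hxu⟩
    obtain ⟨u, b, hug, hu, huB, hubox, hub, hbg, hxb⟩ := key e he hx
    obtain ⟨u', b', -, hu', huB', hubox', hub', hbg', hxb'⟩ := key e' he' hx'
    obtain rfl : b = b' := by
      by_contra hne
      exact Set.disjoint_left.1
        (hC ν g (C.wire_mem _ _ hbg).2 hg b b' hbg hbg' hne) hxb hxb'
    obtain rfl := boxPath_source_unique hub hub' huB huB' hubox hubox'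
    rcases hu with ⟨hu, rfl⟩ | ⟨hu, heu⟩ <;> rcases hu' with ⟨hu', rfl⟩ | ⟨hu', heu'⟩
    · rfl
    · exact absurd hu' hu.ne_union
    · exact absurd hu hu'.ne_union
    · exact ih u (transGen_wire_of_liveBoxPath hug) hu heu heu'

end MSOEnum

namespace MSOEnum

/-- for every hybrid circuit `C`, valuation `ν`, and ∪-gate `g`,
`⟦g⟧_ν` is the union of the `⟦g'⟧_ν` for `g'` ranging over the exits `D^ν_g`,
each of these sets is nonempty, and if `C` is deterministic the union is disjoint. -/
theorem union_gate_exits {α : Type} (C : HybridCircuit α) (ν : α → Bool)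
    (g : α) (hg : g ∈ C.gates) (hτ : C.τ g = GateType.union) :
    (sval C ν g = ⋃ g' ∈ exitsOf C ν g, sval C ν g') ∧
    (∀ g' ∈ exitsOf C ν g, (sval C ν g').Nonempty) ∧
    (deterministic C →
      ∀ g' ∈ exitsOf C ν g, ∀ g'' ∈ exitsOf C ν g, g' ≠ g'' →
        Disjoint (sval C ν g') (sval C ν g'')) := by
  refine ⟨?_, fun e he => sval_nonempty_of_liveUnionPath he.2 he.1.not_isBoolean,
    fun hC e he e' he' hne => Set.disjoint_left.2 fun x hx hx' =>
      hne (exit_unique_of_deterministic hC ν g hτ he he' hx hx')⟩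
  ext x
  simp only [Set.mem_iUnion, exists_prop]
  refine ⟨exists_exit_of_mem_sval C ν g hτ, ?_⟩
  rintro ⟨e, he, hx⟩
  exact sval_subset_of_liveUnionPath he.2 he.1.not_isBoolean hτ hx

end MSOEnum
end

section
/- There is a constant c such that for every hybrid circuit C there exists a hybrid circuit C' with a secondary output g₁ such that: C' is homogenized; C' is equivalent to C; the number of gates of C' is at most c times the number of gates of C; if C is a d-DNNF then so is C'; if C is upwards-deterministic then so is C'; the maximal fan-in of C' is at most the maximum of 3 and the maximal fan-in of C; and the dependency size satisfies Δ(C') ≤ c · Δ(C). -/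
namespace MSOEnum

section Semantics

variable {α : Type} {C : HybridCircuit α} {ν : α → Bool} {g : α} {a : Set α}

theorem HybridCircuit.mem_left {a b : α} (h : C.wire a b) : a ∈ C.gates := (C.wire_mem a b h).1

theorem HybridCircuit.mem_right {a b : α} (h : C.wire a b) : b ∈ C.gates := (C.wire_mem a b h).2

theorem bval_bvar (h : C.τ g = .bvar) : bval C ν g = ν g := by
  unfold bval
  rw [WellFounded.fix_eq]
  simp only [h]

theorem bval_band (h : C.τ g = .band) :
    bval C ν g = true ↔ ∀ g', C.wire g' g → bval C ν g' = true := by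
  unfold bval
  rw [WellFounded.fix_eq]
  simp only [h, decide_eq_true_eq]

theorem bval_bor (h : C.τ g = .bor) :
    bval C ν g = true ↔ ∃ g', C.wire g' g ∧ bval C ν g' = true := by
  unfold bval
  rw [WellFounded.fix_eq]
  simp only [h, decide_eq_true_eq, exists_prop]

theorem bval_bnot (h : C.τ g = .bnot) :
    bval C ν g = true ↔ ∀ g', C.wire g' g → bval C ν g' = false := by
  unfold bval
  rw [WellFounded.fix_eq]
  simp only [h, decide_eq_true_eq]

theorem sval_svar (h : C.τ g = .svar) : sval C ν g = {{g}} := by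
  unfold sval
  rw [WellFounded.fix_eq]
  simp only [h]

theorem mem_sval_union (h : C.τ g = .union) :
    a ∈ sval C ν g ↔ ∃ g', C.wire g' g ∧ a ∈ sval C ν g' := by
  unfold sval
  rw [WellFounded.fix_eq]
  simp only [h, Set.mem_ofPred_eq, exists_prop]

theorem sval_prod_of_forall_not (h : C.τ g = .prod) (h0 : ∀ g', ¬ C.wire g' g) :
    sval C ν g = {∅} := by
  unfold sval
  rw [WellFounded.fix_eq]
  simp only [h, if_pos h0]

theorem mem_sval_box (h : C.τ g = .box) :
    a ∈ sval C ν g ↔ (∃ g', C.wire g' g ∧ ¬ (C.τ g').isBoolean ∧ a ∈ sval C ν g') ∧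
      ∀ g', C.wire g' g → (C.τ g').isBoolean → bval C ν g' = true := by
  unfold sval
  rw [WellFounded.fix_eq]
  simp only [h, Set.mem_ofPred_eq, exists_prop]

theorem sval_of_isBoolean (h : (C.τ g).isBoolean) : sval C ν g = ∅ := by
  unfold sval
  rw [WellFounded.fix_eq]
  revert h
  cases h : C.τ g <;> simp [GateType.isBoolean]

/-- `g` is a ×-gate whose two inputs are `p.1` and `p.2`. -/
structure IsFactors (C : HybridCircuit α) (g : α) (p : α × α) : Prop where
  type_eq : C.τ g = .prod
  ne : p.1 ≠ p.2
  wire_fst : C.wire p.1 g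
  wire_snd : C.wire p.2 g
  eq_or_eq : ∀ g', C.wire g' g → g' = p.1 ∨ g' = p.2

theorem mem_sval_prod {p : α × α} (h : IsFactors C g p) :
    a ∈ sval C ν g ↔ ∃ a₁ ∈ sval C ν p.1, ∃ a₂ ∈ sval C ν p.2, a = a₁ ∪ a₂ := by
  have key : a ∈ sval C ν g ↔ ∃ g₁ g₂, C.wire g₁ g ∧ C.wire g₂ g ∧ g₁ ≠ g₂ ∧
      ∃ a₁ ∈ sval C ν g₁, ∃ a₂ ∈ sval C ν g₂, a = a₁ ∪ a₂ := by
    have h0 : ¬ ∀ g', ¬ C.wire g' g := fun h0 => h0 _ h.wire_fst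
    unfold sval
    rw [WellFounded.fix_eq]
    simp only [h.type_eq, if_neg h0, Set.mem_ofPred_eq, exists_prop]
  rw [key]
  constructor
  · rintro ⟨g₁, g₂, w₁, w₂, hne, a₁, h₁, a₂, h₂, rfl⟩
    rcases h.eq_or_eq _ w₁ with rfl | rfl <;> rcases h.eq_or_eq _ w₂ with rfl | rfl
    · exact absurd rfl hne
    · exact ⟨a₁, h₁, a₂, h₂, rfl⟩
    · exact ⟨a₂, h₂, a₁, h₁, Set.union_comm _ _⟩
    · exact absurd rfl hne
  · rintro ⟨a₁, h₁, a₂, h₂, rfl⟩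
    exact ⟨_, _, h.wire_fst, h.wire_snd, h.ne, a₁, h₁, a₂, h₂, rfl⟩

/-- Captured assignments consist of svar-gates having a path to the capturing gate. -/
theorem reaches_of_mem_sval (g : α) :
    ∀ a ∈ sval C ν g, ∀ v ∈ a, C.τ v = .svar ∧ Relation.ReflTransGen C.wire v g := by
  induction g using C.acyclic.induction with
  | _ g ih =>
  intro a ha v hv
  have step : ∀ g', C.wire g' g → ∀ b ∈ sval C ν g', v ∈ b →
      C.τ v = .svar ∧ Relation.ReflTransGen C.wire v g := fun g' w b hb hvb =>
    ⟨(ih g' w b hb v hvb).1, (ih g' w b hb v hvb).2.tail w⟩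
  by_cases hB : (C.τ g).isBoolean
  · simp [sval_of_isBoolean hB] at ha
  cases hτ : C.τ g with
  | svar =>
    rw [sval_svar hτ, Set.mem_singleton_iff] at ha
    subst ha
    rw [Set.mem_singleton_iff] at hv
    subst hv
    exact ⟨hτ, .refl⟩
  | union =>
    obtain ⟨g', w, h⟩ := (mem_sval_union hτ).1 ha
    exact step g' w a h hv
  | prod =>
    by_cases h0 : ∀ g', ¬ C.wire g' g
    · rw [sval_prod_of_forall_not hτ h0, Set.mem_singleton_iff] at ha
      simp [ha] at hv
    · push Not at h0
      obtain ⟨g', w⟩ := h0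
      obtain h0 | ⟨g₁, g₂, hne, w₁, w₂, hall⟩ := C.prod_inputs g (C.mem_right w) hτ
      · exact absurd w (h0 g')
      · obtain ⟨a₁, h₁, a₂, h₂, rfl⟩ :=
          (mem_sval_prod (p := (g₁, g₂)) ⟨hτ, hne, w₁, w₂, hall⟩).1 ha
        rcases hv with hv | hv
        · exact step _ w₁ _ h₁ hv
        · exact step _ w₂ _ h₂ hv
  | box =>
    obtain ⟨⟨g', w, -, h⟩, -⟩ := (mem_sval_box hτ).1 ha
    exact step g' w a h hv
  | bvar => simp [hτ, GateType.isBoolean] at hB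
  | band => simp [hτ, GateType.isBoolean] at hB
  | bor => simp [hτ, GateType.isBoolean] at hB
  | bnot => simp [hτ, GateType.isBoolean] at hB

theorem deltaSet_finite (hg : g ∈ C.gates) : (deltaSet C g).Finite := by
  refine C.gates.finite_toSet.subset fun g' h => ?_
  induction h with
  | refl => exact hg
  | tail _ w _ => exact C.mem_right w

end Semantics

namespace Homogenization

/-- The gates replacing a gate `g`: `pos` captures the nonempty assignments of `g`
(or the value of `g`, if `g` is Boolean) and `emp` tells whether `g` captures `∅`. If `g` is a
×-gate, then `mul`, `left`, `right` capture the assignments for which both factors, only the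
first factor, or only the second factor contribute a nonempty assignment. -/
inductive Kind : Type
  | pos | emp | mul | left | right
  deriving DecidableEq

instance : Fintype Kind := ⟨{.pos, .emp, .mul, .left, .right}, fun k => by cases k <;> simp⟩

variable {α : Type} (C : HybridCircuit α)

theorem exists_factors (g : α) : ∃ p : α × α,
    C.τ g = .prod → (∃ g', C.wire g' g) → IsFactors C g p := by
  by_cases h : C.τ g = .prod ∧ ∃ g', C.wire g' g
  · obtain ⟨hτ, g', w⟩ := h
    obtain h0 | ⟨g₁, g₂, hne, w₁, w₂, hall⟩ := C.prod_inputs g (C.mem_right w) hτ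
    · exact absurd w (h0 g')
    · exact ⟨(g₁, g₂), fun _ _ => ⟨hτ, hne, w₁, w₂, hall⟩⟩
  · exact ⟨(C.out, C.out), fun h₁ h₂ => absurd ⟨h₁, h₂⟩ h⟩

/-- The two inputs of a ×-gate, in an arbitrarily chosen order. -/
noncomputable def factors (g : α) : α × α := (exists_factors C g).choose

def HasFactors (g : α) : Prop := IsFactors C g (factors C g)

variable {C} in
theorem hasFactors {g g' : α} (hτ : C.τ g = .prod) (w : C.wire g' g) : HasFactors C g :=
  (exists_factors C g).choose_spec hτ ⟨g', w⟩

theorem exists_index : ∃ e : α → ℕ, Set.InjOn e C.gates :=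
  Set.countable_iff_exists_injOn.1 C.gates.countable_toSet

noncomputable def index : α → ℕ := (exists_index C).choose

theorem index_injOn : Set.InjOn (index C) C.gates := (exists_index C).choose_spec

noncomputable def unindex : ℕ → α :=
  haveI : Nonempty α := ⟨C.out⟩
  Function.invFunOn (index C) C.gates

variable {C} in
theorem unindex_index {g : α} (hg : g ∈ C.gates) : unindex C (index C g) = g :=
  haveI : Nonempty α := ⟨C.out⟩
  (index_injOn C).leftInvOn_invFunOn hg

noncomputable def enc (g : α) : Kind → α ⊕ ℕ
  | .pos => .inl g
  | .emp => .inr (Nat.pair (index C g) 0)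
  | .mul => .inr (Nat.pair (index C g) 1)
  | .left => .inr (Nat.pair (index C g) 2)
  | .right => .inr (Nat.pair (index C g) 3)

noncomputable def dec : α ⊕ ℕ → α × Kind
  | .inl g => (g, .pos)
  | .inr n => (unindex C n.unpair.1,
      match n.unpair.2 with
      | 0 => .emp
      | 1 => .mul
      | 2 => .left
      | _ => .right)

variable {C}

theorem dec_enc {g : α} (hg : g ∈ C.gates) (k : Kind) : dec C (enc C g k) = (g, k) := by
  cases k <;> simp [enc, dec, unindex_index hg]

theorem enc_inj {g h : α} {k m : Kind} (hg : g ∈ C.gates) (hh : h ∈ C.gates)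
    (e : enc C g k = enc C h m) : g = h ∧ k = m := by
  have := congrArg (dec C) e
  rw [dec_enc hg, dec_enc hh] at this
  exact Prod.mk.inj this

variable (C)

/-- The wires of the homogenized circuit. -/
inductive Wire : α → Kind → α → Kind → Prop
  | pos {g h} : C.wire g h → C.τ h ≠ .prod → Wire g .pos h .pos
  | emp_bool {g h} : C.wire g h → (C.τ g).isBoolean → Wire g .pos h .emp
  | emp_set {g h} : C.wire g h → ¬ (C.τ g).isBoolean → Wire g .emp h .emp
  | mul {g h} : C.wire g h → C.τ h = .prod → Wire g .pos h .mul
  | left_pos {h} : HasFactors C h → Wire (factors C h).1 .pos h .left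
  | left_emp {h} : HasFactors C h → Wire (factors C h).2 .emp h .left
  | right_pos {h} : HasFactors C h → Wire (factors C h).2 .pos h .right
  | right_emp {h} : HasFactors C h → Wire (factors C h).1 .emp h .right
  | mul_pos {h} : h ∈ C.gates → C.τ h = .prod → Wire h .mul h .pos
  | left_out {h} : h ∈ C.gates → C.τ h = .prod → Wire h .left h .pos
  | right_out {h} : h ∈ C.gates → C.τ h = .prod → Wire h .right h .pos

open Classical in
/-- The types of the gates of the homogenized circuit. -/
noncomputable def type (g : α) : Kind → GateType
  | .pos => if C.τ g = .prod then .union else C.τ g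
  | .emp => if C.τ g = .prod ∨ C.τ g = .box then .band else .bor
  | .mul => if HasFactors C g then .prod else .union
  | .left => if HasFactors C g then .box else .union
  | .right => if HasFactors C g then .box else .union

variable {C}

theorem Wire.wire_or_eq {g h : α} {k m : Kind} (w : Wire C g k h m) :
    C.wire g h ∨ g = h ∧ h ∈ C.gates ∧ k ≠ .pos ∧ m = .pos := by
  cases w with
  | pos w _ | emp_bool w _ | emp_set w _ | mul w _ => exact .inl w
  | left_pos H | right_emp H => exact .inl H.wire_fst
  | left_emp H | right_pos H => exact .inl H.wire_snd
  | mul_pos hh _ | left_out hh _ | right_out hh _ => exact .inr ⟨rfl, hh, by simp, rfl⟩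

theorem Wire.mem {g h : α} {k m : Kind} (w : Wire C g k h m) : g ∈ C.gates ∧ h ∈ C.gates := by
  rcases w.wire_or_eq with w | ⟨rfl, hh, -⟩
  · exact C.wire_mem _ _ w
  · exact ⟨hh, hh⟩

theorem type_pos {g : α} (h : C.τ g ≠ .prod) : type C g .pos = C.τ g := if_neg h

theorem type_pos_of_prod {g : α} (h : C.τ g = .prod) : type C g .pos = .union := if_pos h

theorem isBoolean_type_pos {g : α} : (type C g .pos).isBoolean ↔ (C.τ g).isBoolean := by
  by_cases h : C.τ g = .prod
  · rw [type_pos_of_prod h, h]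
    simp [GateType.isBoolean]
  · rw [type_pos h]

theorem isBoolean_type_emp (g : α) : (type C g .emp).isBoolean := by
  unfold type
  split_ifs <;> trivial

theorem not_isBoolean_type {g : α} {k : Kind} (hp : k ≠ .pos) (he : k ≠ .emp) :
    ¬ (type C g k).isBoolean := by
  cases k <;> simp_all only [type, ne_eq, not_true_eq_false, reduceCtorEq] <;>
    split_ifs <;> simp [GateType.isBoolean]

variable (C) in
/-- The wires of the homogenized circuit, in terms of encoded gates. -/
def encWire (a b : α ⊕ ℕ) : Prop :=
  ∃ g k h m, Wire C g k h m ∧ a = enc C g k ∧ b = enc C h m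

theorem encWire_enc {h : α} (hh : h ∈ C.gates) {m : Kind} {a : α ⊕ ℕ} :
    encWire C a (enc C h m) ↔ ∃ g k, Wire C g k h m ∧ a = enc C g k := by
  constructor
  · rintro ⟨g, k, h', m', w, rfl, e⟩
    obtain ⟨rfl, rfl⟩ := enc_inj hh w.mem.2 e
    exact ⟨g, k, w, rfl⟩
  · rintro ⟨g, k, w, rfl⟩
    exact ⟨g, k, h, m, w, rfl, rfl⟩

theorem encWire_wf : WellFounded (encWire C) := by
  let rank : Kind → ℕ := fun k => if k = .pos then 1 else 0
  refine Subrelation.wf (r := InvImage (Prod.Lex C.wire (InvImage (· < ·) rank)) (dec C)) ?_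
    (InvImage.wf _ (C.acyclic.prod_lex (InvImage.wf rank wellFounded_lt)))
  rintro _ _ ⟨g, k, h, m, w, rfl, rfl⟩
  simp only [InvImage, dec_enc w.mem.1, dec_enc w.mem.2, Prod.lex_def]
  rcases w.wire_or_eq with w | ⟨rfl, -, hk, rfl⟩
  · exact .inl w
  · exact .inr ⟨rfl, by simp [rank, hk]⟩

theorem encWire_of_wire {g h : α} {k m : Kind} (w : Wire C g k h m) :
    encWire C (enc C g k) (enc C h m) := ⟨g, k, h, m, w, rfl, rfl⟩

variable (C) in
/-- The gates of the homogenized circuit. -/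
noncomputable def encGates : Finset (α ⊕ ℕ) := by
  classical exact (C.gates ×ˢ Finset.univ).image fun p => enc C p.1 p.2

theorem mem_encGates {a : α ⊕ ℕ} : a ∈ encGates C ↔ ∃ g ∈ C.gates, ∃ k, enc C g k = a := by
  simp [encGates]

theorem enc_mem_encGates {g : α} (hg : g ∈ C.gates) (k : Kind) : enc C g k ∈ encGates C :=
  mem_encGates.2 ⟨g, hg, k, rfl⟩

variable (C) in
noncomputable def encType (a : α ⊕ ℕ) : GateType := type C (dec C a).1 (dec C a).2

theorem encType_enc {g : α} (hg : g ∈ C.gates) (k : Kind) : encType C (enc C g k) = type C g k := by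
  rw [encType, dec_enc hg]

theorem HasFactors.not_isBoolean {h : α} (H : HasFactors C h) {g : α} (w : C.wire g h) :
    ¬ (C.τ g).isBoolean :=
  C.setGate_inputs h (.inr H.type_eq) g w

variable (C) in
/-- The homogenized circuit. -/
noncomputable def hom : HybridCircuit (α ⊕ ℕ) where
  gates := encGates C
  wire := encWire C
  wire_mem := by
    rintro _ _ ⟨g, k, h, m, w, rfl, rfl⟩
    exact ⟨enc_mem_encGates w.mem.1 k, enc_mem_encGates w.mem.2 m⟩
  acyclic := encWire_wf
  τ := encType C
  out := enc C C.out .pos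
  out_mem := enc_mem_encGates C.out_mem _
  out_setValued := by
    rw [encType_enc C.out_mem, isBoolean_type_pos]
    exact C.out_setValued
  var_no_input := by
    rintro _ hτ _ ⟨g, k, h, m, w, rfl, rfl⟩
    rw [encType_enc w.mem.2] at hτ
    cases m with
    | pos =>
      have hp : C.τ h ≠ .prod := fun hp => by simp [type_pos_of_prod hp] at hτ
      rw [type_pos hp] at hτ
      cases w with
      | pos w _ => exact C.var_no_input h hτ g w
      | mul_pos _ hp' | left_out _ hp' | right_out _ hp' => exact hp hp'
    | emp => unfold type at hτ; split_ifs at hτ <;> simp at hτ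
    | mul => unfold type at hτ; split_ifs at hτ <;> simp at hτ
    | left => unfold type at hτ; split_ifs at hτ <;> simp at hτ
    | right => unfold type at hτ; split_ifs at hτ <;> simp at hτ
  boolGate_inputs := by
    rintro _ hτ _ ⟨g, k, h, m, w, rfl, rfl⟩
    rw [encType_enc w.mem.2] at hτ
    rw [encType_enc w.mem.1]
    cases w with
    | pos w hp =>
      rw [type_pos hp] at hτ
      exact isBoolean_type_pos.2 (C.boolGate_inputs h hτ g w)
    | emp_bool w hb => exact isBoolean_type_pos.2 hb
    | emp_set w hb => exact isBoolean_type_emp g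
    | mul => unfold type at hτ; split_ifs at hτ <;> simp at hτ
    | left_pos | left_emp | right_pos | right_emp =>
      unfold type at hτ; split_ifs at hτ <;> simp at hτ
    | mul_pos _ hp | left_out _ hp | right_out _ hp => simp [type_pos_of_prod hp] at hτ
  bnot_input := by
    intro a ha hτ
    obtain ⟨h, hh, m, rfl⟩ := mem_encGates.1 ha
    rw [encType_enc hh] at hτ
    cases m with
    | pos =>
      have hp : C.τ h ≠ .prod := fun hp => by simp [type_pos_of_prod hp] at hτ
      rw [type_pos hp] at hτ
      obtain ⟨g, w, hu⟩ := C.bnot_input h hh hτ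
      refine ⟨enc C g .pos, encWire_of_wire (.pos w hp), fun b hb => ?_⟩
      obtain ⟨g', k, w', rfl⟩ := (encWire_enc hh).1 hb
      cases w' with
      | pos w' _ => rw [hu _ w']
      | mul_pos _ hp' | left_out _ hp' | right_out _ hp' => exact absurd hp' hp
    | emp => unfold type at hτ; split_ifs at hτ
    | mul => unfold type at hτ; split_ifs at hτ
    | left => unfold type at hτ; split_ifs at hτ
    | right => unfold type at hτ; split_ifs at hτ
  setGate_inputs := by
    rintro _ hτ _ ⟨g, k, h, m, w, rfl, rfl⟩
    rw [encType_enc w.mem.2] at hτ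
    rw [encType_enc w.mem.1]
    cases w with
    | pos w hp =>
      rw [type_pos hp] at hτ
      exact isBoolean_type_pos.not.2 (C.setGate_inputs h hτ g w)
    | emp_bool | emp_set => unfold type at hτ; split_ifs at hτ <;> simp at hτ
    | mul w hp => exact isBoolean_type_pos.not.2 (C.setGate_inputs h (.inr hp) g w)
    | left_pos H | left_emp H | right_pos H | right_emp H => simp [type, H] at hτ
    | mul_pos | left_out | right_out => exact not_isBoolean_type (by simp) (by simp)
  prod_inputs := by
    intro a ha hτ
    obtain ⟨h, hh, m, rfl⟩ := mem_encGates.1 ha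
    rw [encType_enc hh] at hτ
    cases m with
    | mul =>
      have H : HasFactors C h := by
        by_contra H
        simp [type, H] at hτ
      refine .inr ⟨_, _, fun e => H.ne ?_, encWire_of_wire (.mul H.wire_fst H.type_eq),
        encWire_of_wire (.mul H.wire_snd H.type_eq), fun b hb => ?_⟩
      · exact (enc_inj (C.mem_left H.wire_fst) (C.mem_left H.wire_snd) e).1
      · obtain ⟨g', k, w', rfl⟩ := (encWire_enc hh).1 hb
        cases w' with
        | mul w' _ => exact (H.eq_or_eq _ w').imp (congrArg _) (congrArg _)
    | pos =>
      by_cases hp : C.τ h = .prod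
      · simp [type_pos_of_prod hp] at hτ
      · exact absurd (type_pos hp ▸ hτ) hp
    | emp => unfold type at hτ; split_ifs at hτ
    | left => unfold type at hτ; split_ifs at hτ
    | right => unfold type at hτ; split_ifs at hτ
  box_inputs := by
    intro a ha hτ
    obtain ⟨h, hh, m, rfl⟩ := mem_encGates.1 ha
    rw [encType_enc hh] at hτ
    cases m with
    | pos =>
      have hp : C.τ h ≠ .prod := fun hp => by simp [type_pos_of_prod hp] at hτ
      rw [type_pos hp] at hτ
      obtain ⟨s, b, hs, hb, ws, wb, hall⟩ := C.box_inputs h hh hτ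
      refine ⟨enc C s .pos, enc C b .pos, ?_, ?_, encWire_of_wire (.pos ws hp),
        encWire_of_wire (.pos wb hp), fun c hc => ?_⟩
      · rwa [encType_enc (C.mem_left ws), isBoolean_type_pos]
      · rwa [encType_enc (C.mem_left wb), isBoolean_type_pos]
      · obtain ⟨g', k, w', rfl⟩ := (encWire_enc hh).1 hc
        cases w' with
        | pos w' _ => exact (hall _ w').imp (congrArg (enc C · .pos)) (congrArg (enc C · .pos))
        | mul_pos _ hp' | left_out _ hp' | right_out _ hp' => exact absurd hp' hp
    | emp => unfold type at hτ; split_ifs at hτ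
    | mul => unfold type at hτ; split_ifs at hτ
    | left =>
      have H : HasFactors C h := by
        by_contra H
        simp [type, H] at hτ
      refine ⟨_, _, ?_, ?_, encWire_of_wire (.left_pos H), encWire_of_wire (.left_emp H),
        fun c hc => ?_⟩
      · rw [encType_enc (C.mem_left H.wire_fst), isBoolean_type_pos]
        exact H.not_isBoolean H.wire_fst
      · rw [encType_enc (C.mem_left H.wire_snd)]
        exact isBoolean_type_emp _
      · obtain ⟨g', k, w', rfl⟩ := (encWire_enc hh).1 hc
        cases w' with
        | left_pos => exact .inl rfl
        | left_emp => exact .inr rfl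
    | right =>
      have H : HasFactors C h := by
        by_contra H
        simp [type, H] at hτ
      refine ⟨_, _, ?_, ?_, encWire_of_wire (.right_pos H), encWire_of_wire (.right_emp H),
        fun c hc => ?_⟩
      · rw [encType_enc (C.mem_left H.wire_snd), isBoolean_type_pos]
        exact H.not_isBoolean H.wire_snd
      · rw [encType_enc (C.mem_left H.wire_fst)]
        exact isBoolean_type_emp _
      · obtain ⟨g', k, w', rfl⟩ := (encWire_enc hh).1 hc
        cases w' with
        | right_pos => exact .inl rfl
        | right_emp => exact .inr rfl

theorem hom_τ {g : α} (hg : g ∈ C.gates) (k : Kind) : (hom C).τ (enc C g k) = type C g k :=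
  encType_enc hg k

theorem hom_wire {h : α} (hh : h ∈ C.gates) {m : Kind} {a : α ⊕ ℕ} :
    (hom C).wire a (enc C h m) ↔ ∃ g k, Wire C g k h m ∧ a = enc C g k :=
  encWire_enc hh

theorem hom_wire_pos {h : α} (hh : h ∈ C.gates) (hp : C.τ h ≠ .prod) {a : α ⊕ ℕ} :
    (hom C).wire a (enc C h .pos) ↔ ∃ g, C.wire g h ∧ a = enc C g .pos := by
  rw [hom_wire hh]
  constructor
  · rintro ⟨g, k, w, rfl⟩
    cases w with
    | pos w _ => exact ⟨g, w, rfl⟩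
    | mul_pos _ hp' | left_out _ hp' | right_out _ hp' => exact absurd hp' hp
  · rintro ⟨g, w, rfl⟩
    exact ⟨g, .pos, .pos w hp, rfl⟩

theorem hom_wire_pos_of_prod {h : α} (hh : h ∈ C.gates) (hp : C.τ h = .prod) {a : α ⊕ ℕ} :
    (hom C).wire a (enc C h .pos) ↔
      a = enc C h .mul ∨ a = enc C h .left ∨ a = enc C h .right := by
  rw [hom_wire hh]
  constructor
  · rintro ⟨g, k, w, rfl⟩
    cases w with
    | pos _ hp' => exact absurd hp hp'
    | mul_pos | left_out | right_out => simp
  · rintro (rfl | rfl | rfl)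
    exacts [⟨h, _, .mul_pos hh hp, rfl⟩, ⟨h, _, .left_out hh hp, rfl⟩,
      ⟨h, _, .right_out hh hp, rfl⟩]

variable (C) in
open Classical in
/-- The gate telling whether a set-valued gate captures `∅`, or whether a Boolean gate is true. -/
noncomputable def test (g : α) : α ⊕ ℕ := if (C.τ g).isBoolean then enc C g .pos else enc C g .emp

theorem hom_wire_emp {h : α} (hh : h ∈ C.gates) {a : α ⊕ ℕ} :
    (hom C).wire a (enc C h .emp) ↔ ∃ g, C.wire g h ∧ a = test C g := by
  rw [hom_wire hh]
  constructor
  · rintro ⟨g, k, w, rfl⟩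
    cases w with
    | emp_bool w hb => exact ⟨g, w, by rw [test, if_pos hb]⟩
    | emp_set w hb => exact ⟨g, w, by rw [test, if_neg hb]⟩
  · rintro ⟨g, w, rfl⟩
    by_cases hb : (C.τ g).isBoolean
    · exact ⟨g, .pos, .emp_bool w hb, by rw [test, if_pos hb]⟩
    · exact ⟨g, .emp, .emp_set w hb, by rw [test, if_neg hb]⟩

theorem hom_wire_mul {h : α} (hh : h ∈ C.gates) (hp : C.τ h = .prod) {a : α ⊕ ℕ} :
    (hom C).wire a (enc C h .mul) ↔ ∃ g, C.wire g h ∧ a = enc C g .pos := by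
  rw [hom_wire hh]
  constructor
  · rintro ⟨g, k, w, rfl⟩
    cases w with
    | mul w _ => exact ⟨g, w, rfl⟩
  · rintro ⟨g, w, rfl⟩
    exact ⟨g, .pos, .mul w hp, rfl⟩

theorem hom_wire_left {h : α} (H : HasFactors C h) {a : α ⊕ ℕ} :
    (hom C).wire a (enc C h .left) ↔
      a = enc C (factors C h).1 .pos ∨ a = enc C (factors C h).2 .emp := by
  rw [hom_wire (C.mem_right H.wire_fst)]
  constructor
  · rintro ⟨g, k, w, rfl⟩
    cases w <;> simp
  · rintro (rfl | rfl)
    exacts [⟨_, _, .left_pos H, rfl⟩, ⟨_, _, .left_emp H, rfl⟩]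

theorem hom_wire_right {h : α} (H : HasFactors C h) {a : α ⊕ ℕ} :
    (hom C).wire a (enc C h .right) ↔
      a = enc C (factors C h).2 .pos ∨ a = enc C (factors C h).1 .emp := by
  rw [hom_wire (C.mem_right H.wire_fst)]
  constructor
  · rintro ⟨g, k, w, rfl⟩
    cases w <;> simp
  · rintro (rfl | rfl)
    exacts [⟨_, _, .right_pos H, rfl⟩, ⟨_, _, .right_emp H, rfl⟩]

theorem not_hom_wire_of_not_hasFactors {h : α} (hh : h ∈ C.gates) (H : ¬ HasFactors C h)
    {m : Kind} (hp : m ≠ .pos) (he : m ≠ .emp) (a : α ⊕ ℕ) : ¬ (hom C).wire a (enc C h m) := by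
  rw [hom_wire hh]
  rintro ⟨g, k, w, rfl⟩
  cases w with
  | pos | mul_pos | left_out | right_out => exact hp rfl
  | emp_bool | emp_set => exact he rfl
  | mul w hp' => exact H (hasFactors hp' w)
  | left_pos H' | left_emp H' | right_pos H' | right_emp H' => exact H H'

variable {ν : α ⊕ ℕ → Bool}

theorem bval_hom_pos (g : α) : g ∈ C.gates → (C.τ g).isBoolean →
    bval (hom C) ν (enc C g .pos) = bval C (ν ∘ Sum.inl) g := by
  induction g using C.acyclic.induction with
  | _ g ih =>
  intro hg hB
  have hp : C.τ g ≠ .prod := fun hp => by simp [hp, GateType.isBoolean] at hB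
  have hτ := (hom_τ hg .pos).trans (type_pos hp)
  have ih' (h : C.τ g = .band ∨ C.τ g = .bor ∨ C.τ g = .bnot) (g' : α) (w : C.wire g' g) :
      bval (hom C) ν (enc C g' .pos) = bval C (ν ∘ Sum.inl) g' :=
    ih g' w (C.mem_left w) (C.boolGate_inputs g h g' w)
  cases h : C.τ g with
  | bvar => rw [bval_bvar h, bval_bvar (hτ.trans h), enc, Function.comp]
  | band =>
    rw [Bool.eq_iff_iff, bval_band h, bval_band (hτ.trans h)]
    simp only [hom_wire_pos hg hp, forall_exists_index, and_imp]
    refine ⟨fun H g' w => ?_, ?_⟩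
    · rw [← ih' (by simp [h]) g' w]
      exact H _ g' w rfl
    · rintro H _ g' w rfl
      rw [ih' (by simp [h]) g' w]
      exact H g' w
  | bor =>
    rw [Bool.eq_iff_iff, bval_bor h, bval_bor (hτ.trans h)]
    simp only [hom_wire_pos hg hp]
    constructor
    · rintro ⟨_, ⟨g', w, rfl⟩, H⟩
      exact ⟨g', w, ih' (by simp [h]) g' w ▸ H⟩
    · rintro ⟨g', w, H⟩
      exact ⟨_, ⟨g', w, rfl⟩, (ih' (by simp [h]) g' w).trans H⟩
  | bnot =>
    rw [Bool.eq_iff_iff, bval_bnot h, bval_bnot (hτ.trans h)]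
    simp only [hom_wire_pos hg hp]
    constructor
    · intro H g' w
      exact ih' (by simp [h]) g' w ▸ H _ ⟨g', w, rfl⟩
    · rintro H _ ⟨g', w, rfl⟩
      exact (ih' (by simp [h]) g' w).trans (H g' w)
  | svar => simp [h, GateType.isBoolean] at hB
  | union => simp [h, GateType.isBoolean] at hB
  | prod => simp [h, GateType.isBoolean] at hB
  | box => simp [h, GateType.isBoolean] at hB

theorem bval_hom_emp (g : α) : g ∈ C.gates → ¬ (C.τ g).isBoolean →
    (bval (hom C) ν (enc C g .emp) = true ↔ ∅ ∈ sval C (ν ∘ Sum.inl) g) := by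
  induction g using C.acyclic.induction with
  | _ g ih =>
  intro hg hB
  have hτ := hom_τ hg .emp
  have test_set (g' : α) (w : C.wire g' g) (hs : ¬ (C.τ g').isBoolean) :
      bval (hom C) ν (test C g') = true ↔ ∅ ∈ sval C (ν ∘ Sum.inl) g' := by
    rw [test, if_neg hs, ih g' w (C.mem_left w) hs]
  cases h : C.τ g with
  | svar =>
    rw [bval_bor (hτ.trans (by simp [type, h])), sval_svar h]
    simp only [hom_wire_emp hg, C.var_no_input g (.inl h)]
    simp
  | union =>
    have hs g' w := test_set g' w (C.setGate_inputs g (.inl h) g' w)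
    rw [bval_bor (hτ.trans (by simp [type, h])), mem_sval_union h]
    simp only [hom_wire_emp hg]
    constructor
    · rintro ⟨_, ⟨g', w, rfl⟩, H⟩
      exact ⟨g', w, (hs g' w).1 H⟩
    · rintro ⟨g', w, H⟩
      exact ⟨_, ⟨g', w, rfl⟩, (hs g' w).2 H⟩
  | prod =>
    have hs g' w := test_set g' w (C.setGate_inputs g (.inr h) g' w)
    rw [bval_band (hτ.trans (by simp [type, h]))]
    simp only [hom_wire_emp hg]
    by_cases h0 : ∀ g', ¬ C.wire g' g
    · simp [sval_prod_of_forall_not h h0, h0]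
    · push Not at h0
      obtain ⟨g', w⟩ := h0
      have H := hasFactors h w
      rw [mem_sval_prod H]
      constructor
      · intro hall
        exact ⟨∅, (hs _ H.wire_fst).1 (hall _ ⟨_, H.wire_fst, rfl⟩),
          ∅, (hs _ H.wire_snd).1 (hall _ ⟨_, H.wire_snd, rfl⟩), by simp⟩
      · rintro ⟨a₁, h₁, a₂, h₂, e⟩ _ ⟨g'', w', rfl⟩
        obtain ⟨rfl, rfl⟩ := Set.union_empty_iff.1 e.symm
        rw [hs _ w']
        rcases H.eq_or_eq _ w' with rfl | rfl <;> assumption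
  | box =>
    rw [bval_band (hτ.trans (by simp [type, h])), mem_sval_box h]
    simp only [hom_wire_emp hg]
    obtain ⟨s, b, hs, hb, ws, wb, hall⟩ := C.box_inputs g hg h
    have test_bool (g' : α) (w : C.wire g' g) (hb : (C.τ g').isBoolean) :
        bval (hom C) ν (test C g') = bval C (ν ∘ Sum.inl) g' := by
      rw [test, if_pos hb, bval_hom_pos g' (C.mem_left w) hb]
    constructor
    · intro H
      refine ⟨⟨s, ws, hs, (test_set s ws hs).1 (H _ ⟨s, ws, rfl⟩)⟩, fun g' w hb' => ?_⟩
      rw [← test_bool g' w hb']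
      exact H _ ⟨g', w, rfl⟩
    · rintro ⟨⟨g₁, w₁, hs₁, h₁⟩, h₂⟩ _ ⟨g', w, rfl⟩
      by_cases hb' : (C.τ g').isBoolean
      · rw [test_bool g' w hb']
        exact h₂ g' w hb'
      · have hs' (x : α) (w : C.wire x g) (hx : ¬ (C.τ x).isBoolean) : x = s :=
          (hall x w).resolve_right fun e => hx (e ▸ hb)
        rw [test_set g' w hb', hs' g' w hb', ← hs' g₁ w₁ hs₁]
        exact h₁
  | bvar => simp [h, GateType.isBoolean] at hB
  | band => simp [h, GateType.isBoolean] at hB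
  | bor => simp [h, GateType.isBoolean] at hB
  | bnot => simp [h, GateType.isBoolean] at hB

theorem sval_hom_eq_empty {h : α} (hh : h ∈ C.gates) (H : ¬ HasFactors C h)
    {m : Kind} (hp : m ≠ .pos) (he : m ≠ .emp) : sval (hom C) ν (enc C h m) = ∅ := by
  have hτ : (hom C).τ (enc C h m) = .union := by
    rw [hom_τ hh]
    cases m <;> simp_all [type]
  ext A
  simp [mem_sval_union hτ, not_hom_wire_of_not_hasFactors hh H hp he]

theorem isFactors_mul {h : α} (H : HasFactors C h) :
    IsFactors (hom C) (enc C h .mul)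
      (enc C (factors C h).1 .pos, enc C (factors C h).2 .pos) where
  type_eq := by rw [hom_τ (C.mem_right H.wire_fst)]; simp [type, H]
  ne e := H.ne (enc_inj (k := .pos) (m := .pos)
    (C.mem_left H.wire_fst) (C.mem_left H.wire_snd) e).1
  wire_fst := (hom_wire_mul (C.mem_right H.wire_fst) H.type_eq).2 ⟨_, H.wire_fst, rfl⟩
  wire_snd := (hom_wire_mul (C.mem_right H.wire_fst) H.type_eq).2 ⟨_, H.wire_snd, rfl⟩
  eq_or_eq a w := by
    obtain ⟨g, w', rfl⟩ := (hom_wire_mul (C.mem_right H.wire_fst) H.type_eq).1 w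
    exact (H.eq_or_eq g w').imp (congrArg (enc C · .pos)) (congrArg (enc C · .pos))

variable {A : Set (α ⊕ ℕ)}

theorem not_isBoolean_hom_pos {g h : α} (H : HasFactors C h) (w : C.wire g h) :
    ¬ ((hom C).τ (enc C g .pos)).isBoolean := by
  rw [hom_τ (C.mem_left w), isBoolean_type_pos]
  exact H.not_isBoolean w

theorem isBoolean_hom_emp {g : α} (hg : g ∈ C.gates) : ((hom C).τ (enc C g .emp)).isBoolean := by
  rw [hom_τ hg]
  exact isBoolean_type_emp g

theorem mem_sval_hom_left {h : α} (H : HasFactors C h) :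
    A ∈ sval (hom C) ν (enc C h .left) ↔
      A ∈ sval (hom C) ν (enc C (factors C h).1 .pos) ∧
        ∅ ∈ sval C (ν ∘ Sum.inl) (factors C h).2 := by
  have hτ : (hom C).τ (enc C h .left) = .box := by
    rw [hom_τ (C.mem_right H.wire_fst)]; simp [type, H]
  have n₁ := not_isBoolean_hom_pos H H.wire_fst
  have b₂ := isBoolean_hom_emp (C.mem_left H.wire_snd)
  rw [mem_sval_box hτ, ← bval_hom_emp _ (C.mem_left H.wire_snd) (H.not_isBoolean H.wire_snd)]
  simp only [hom_wire_left H]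
  constructor
  · rintro ⟨⟨_, rfl | rfl, hb, hA⟩, hall⟩
    · exact ⟨hA, hall _ (.inr rfl) b₂⟩
    · exact absurd b₂ hb
  · rintro ⟨hA, hb⟩
    refine ⟨⟨_, .inl rfl, n₁, hA⟩, ?_⟩
    rintro _ (rfl | rfl) hb'
    exacts [absurd hb' n₁, hb]

theorem mem_sval_hom_right {h : α} (H : HasFactors C h) :
    A ∈ sval (hom C) ν (enc C h .right) ↔
      A ∈ sval (hom C) ν (enc C (factors C h).2 .pos) ∧
        ∅ ∈ sval C (ν ∘ Sum.inl) (factors C h).1 := by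
  have hτ : (hom C).τ (enc C h .right) = .box := by
    rw [hom_τ (C.mem_right H.wire_fst)]; simp [type, H]
  have n₂ := not_isBoolean_hom_pos H H.wire_snd
  have b₁ := isBoolean_hom_emp (C.mem_left H.wire_fst)
  rw [mem_sval_box hτ, ← bval_hom_emp _ (C.mem_left H.wire_fst) (H.not_isBoolean H.wire_fst)]
  simp only [hom_wire_right H]
  constructor
  · rintro ⟨⟨_, rfl | rfl, hb, hA⟩, hall⟩
    · exact ⟨hA, hall _ (.inr rfl) b₁⟩
    · exact absurd b₁ hb
  · rintro ⟨hA, hb⟩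
    refine ⟨⟨_, .inl rfl, n₂, hA⟩, ?_⟩
    rintro _ (rfl | rfl) hb'
    exacts [absurd hb' n₂, hb]

/-- The gate `pos` of `g` captures the nonempty assignments captured by `g`. -/
theorem mem_sval_hom_pos (g : α) : g ∈ C.gates → ∀ A : Set (α ⊕ ℕ),
    (A ∈ sval (hom C) ν (enc C g .pos) ↔
      ∃ a ∈ sval C (ν ∘ Sum.inl) g, a.Nonempty ∧ A = Sum.inl '' a) := by
  induction g using C.acyclic.induction with
  | _ g ih =>
  intro hg A
  have ih' g' w := ih g' w (C.mem_left w)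
  by_cases hB : (C.τ g).isBoolean
  · have hB' : ((hom C).τ (enc C g .pos)).isBoolean := by
      rwa [hom_τ hg, isBoolean_type_pos]
    simp [sval_of_isBoolean hB, sval_of_isBoolean hB']
  cases h : C.τ g with
  | svar =>
    have hτ := (hom_τ hg .pos).trans ((type_pos (by simp [h])).trans h)
    rw [sval_svar hτ]
    simp [sval_svar h, enc]
  | union =>
    have hτ := (hom_τ hg .pos).trans ((type_pos (by simp [h])).trans h)
    rw [mem_sval_union hτ]
    simp only [mem_sval_union h, hom_wire_pos hg (by simp [h])]
    constructor
    · rintro ⟨_, ⟨g', w, rfl⟩, hA⟩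
      obtain ⟨a, ha, hne, rfl⟩ := (ih' g' w A).1 hA
      exact ⟨a, ⟨g', w, ha⟩, hne, rfl⟩
    · rintro ⟨a, ⟨g', w, ha⟩, hne, rfl⟩
      exact ⟨_, ⟨g', w, rfl⟩, (ih' g' w _).2 ⟨a, ha, hne, rfl⟩⟩
  | box =>
    have hτ := (hom_τ hg .pos).trans ((type_pos (by simp [h])).trans h)
    rw [mem_sval_box hτ]
    simp only [mem_sval_box h, hom_wire_pos hg (by simp [h])]
    have hbool (g' : α) (w : C.wire g' g) :
        ((hom C).τ (enc C g' .pos)).isBoolean ↔ (C.τ g').isBoolean := by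
      rw [hom_τ (C.mem_left w), isBoolean_type_pos]
    constructor
    · rintro ⟨⟨_, ⟨g', w, rfl⟩, hs, hA⟩, hall⟩
      obtain ⟨a, ha, hne, rfl⟩ := (ih' g' w A).1 hA
      refine ⟨a, ⟨⟨g', w, (hbool g' w).not.1 hs, ha⟩, fun b wb hb => ?_⟩, hne, rfl⟩
      rw [← bval_hom_pos b (C.mem_left wb) hb]
      exact hall _ ⟨b, wb, rfl⟩ ((hbool b wb).2 hb)
    · rintro ⟨a, ⟨⟨g', w, hs, ha⟩, hall⟩, hne, rfl⟩
      refine ⟨⟨_, ⟨g', w, rfl⟩, (hbool g' w).not.2 hs, (ih' g' w _).2 ⟨a, ha, hne, rfl⟩⟩, ?_⟩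
      rintro _ ⟨b, wb, rfl⟩ hb
      rw [hbool b wb] at hb
      rw [bval_hom_pos b (C.mem_left wb) hb]
      exact hall b wb hb
  | prod =>
    have hτ := (hom_τ hg .pos).trans (type_pos_of_prod h)
    rw [mem_sval_union hτ]
    simp only [hom_wire_pos_of_prod hg h, exists_eq_or_imp, exists_eq_left]
    by_cases h0 : ∀ g', ¬ C.wire g' g
    · have H : ¬ HasFactors C g := fun H => h0 _ H.wire_fst
      rw [sval_hom_eq_empty hg H (by simp) (by simp), sval_hom_eq_empty hg H (by simp) (by simp),
        sval_hom_eq_empty hg H (by simp) (by simp), sval_prod_of_forall_not h h0]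
      simp
    · push Not at h0
      obtain ⟨g', w⟩ := h0
      have H := hasFactors h w
      rw [mem_sval_prod (isFactors_mul H), mem_sval_hom_left H, mem_sval_hom_right H]
      simp only [mem_sval_prod H, ih' _ H.wire_fst, ih' _ H.wire_snd]
      constructor
      · rintro (⟨_, ⟨a₁, h₁, hne, rfl⟩, _, ⟨a₂, h₂, -, rfl⟩, rfl⟩ |
          ⟨⟨a₁, h₁, hne, rfl⟩, h₂⟩ | ⟨⟨a₂, h₂, hne, rfl⟩, h₁⟩)
        · exact ⟨_, ⟨a₁, h₁, a₂, h₂, rfl⟩, hne.inl, (Set.image_union _ _ _).symm⟩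
        · exact ⟨a₁, ⟨a₁, h₁, ∅, h₂, by simp⟩, hne, rfl⟩
        · exact ⟨a₂, ⟨∅, h₁, a₂, h₂, by simp⟩, hne, rfl⟩
      · rintro ⟨_, ⟨a₁, h₁, a₂, h₂, rfl⟩, hne, rfl⟩
        rcases a₁.eq_empty_or_nonempty with rfl | hne₁
        · rw [Set.empty_union] at hne ⊢
          exact .inr (.inr ⟨⟨a₂, h₂, hne, rfl⟩, h₁⟩)
        · rcases a₂.eq_empty_or_nonempty with rfl | hne₂
          · rw [Set.union_empty]
            exact .inr (.inl ⟨⟨a₁, h₁, hne₁, rfl⟩, h₂⟩)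
          · exact .inl ⟨_, ⟨a₁, h₁, hne₁, rfl⟩, _, ⟨a₂, h₂, hne₂, rfl⟩, Set.image_union _ _ _⟩
  | bvar => simp [h, GateType.isBoolean] at hB
  | band => simp [h, GateType.isBoolean] at hB
  | bor => simp [h, GateType.isBoolean] at hB
  | bnot => simp [h, GateType.isBoolean] at hB

theorem nonempty_of_mem_sval_hom_pos {g : α} (hg : g ∈ C.gates)
    (hA : A ∈ sval (hom C) ν (enc C g .pos)) : A.Nonempty := by
  obtain ⟨a, -, hne, rfl⟩ := (mem_sval_hom_pos g hg A).1 hA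
  exact hne.image _

theorem nonempty_of_mem_sval_hom {b : α ⊕ ℕ} (hb : b ∈ (hom C).gates)
    (hA : A ∈ sval (hom C) ν b) : A.Nonempty := by
  obtain ⟨g, hg, k, rfl⟩ := mem_encGates.1 hb
  cases k with
  | pos => exact nonempty_of_mem_sval_hom_pos hg hA
  | emp => simp [sval_of_isBoolean (isBoolean_hom_emp hg)] at hA
  | mul =>
    by_cases H : HasFactors C g
    · obtain ⟨a₁, h₁, a₂, -, rfl⟩ := (mem_sval_prod (isFactors_mul H)).1 hA
      exact (nonempty_of_mem_sval_hom_pos (C.mem_left H.wire_fst) h₁).inl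
    · simp [sval_hom_eq_empty hg H] at hA
  | left =>
    by_cases H : HasFactors C g
    · exact nonempty_of_mem_sval_hom_pos (C.mem_left H.wire_fst) ((mem_sval_hom_left H).1 hA).1
    · simp [sval_hom_eq_empty hg H] at hA
  | right =>
    by_cases H : HasFactors C g
    · exact nonempty_of_mem_sval_hom_pos (C.mem_left H.wire_snd) ((mem_sval_hom_right H).1 hA).1
    · simp [sval_hom_eq_empty hg H] at hA

variable (C) in
theorem homogenized_hom : homogenized (hom C) := by
  rintro ⟨ν, b, hb, -, he⟩
  exact Set.not_nonempty_empty (nonempty_of_mem_sval_hom hb he)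

theorem type_eq_var {g : α} {k : Kind} {t : GateType} (ht : t = .svar ∨ t = .bvar)
    (h : type C g k = t) : k = .pos ∧ C.τ g = t := by
  rcases ht with rfl | rfl <;> cases k <;> unfold type at h <;> dsimp only at h <;>
    split_ifs at h <;> exact ⟨rfl, h⟩

variable (C) in
theorem hom_var {t : GateType} (ht : t = .svar ∨ t = .bvar) :
    {g | g ∈ (hom C).gates ∧ (hom C).τ g = t} = Sum.inl '' {g | g ∈ C.gates ∧ C.τ g = t} := by
  ext b
  constructor
  · rintro ⟨hb, hτ⟩
    obtain ⟨g, hg, k, rfl⟩ := mem_encGates.1 hb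
    rw [hom_τ hg] at hτ
    obtain ⟨rfl, hτ'⟩ := type_eq_var ht hτ
    exact ⟨g, ⟨hg, hτ'⟩, rfl⟩
  · rintro ⟨g, ⟨hg, hτ⟩, rfl⟩
    refine ⟨enc_mem_encGates hg .pos, (hom_τ hg .pos).trans ((type_pos ?_).trans hτ)⟩
    rintro hp
    simp [← hτ, hp] at ht

variable (C) in
theorem sval_hom_out (ν : α ⊕ ℕ → Bool) :
    sval (hom C) ν (hom C).out ∪
        (if bval (hom C) ν (enc C C.out .emp) = true then {(∅ : Set (α ⊕ ℕ))} else ∅) =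
      (fun A : Set α => Sum.inl '' A) '' sval C (ν ∘ Sum.inl) C.out := by
  ext A
  have hout : (hom C).out = enc C C.out .pos := rfl
  have hemp := bval_hom_emp (ν := ν) C.out C.out_mem C.out_setValued
  simp only [hout, Set.mem_union, mem_sval_hom_pos C.out C.out_mem, Set.mem_image]
  constructor
  · rintro (⟨a, ha, -, rfl⟩ | h)
    · exact ⟨a, ha, rfl⟩
    · split_ifs at h with he
      · rw [Set.mem_singleton_iff] at h
        exact ⟨∅, hemp.1 he, by simp [h]⟩
      · exact absurd h (Set.notMem_empty A)
  · rintro ⟨a, ha, rfl⟩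
    rcases a.eq_empty_or_nonempty with rfl | hne
    · simp [hemp.2 ha]
    · exact .inl ⟨a, ha, hne, rfl⟩

theorem card_kind : Fintype.card Kind = 5 := rfl

variable (C) in
theorem card_hom_gates : (hom C).gates.card ≤ 5 * C.gates.card := by
  classical
  have : (encGates C).card ≤ (C.gates ×ˢ (Finset.univ : Finset Kind)).card := by
    unfold encGates
    convert Finset.card_image_le
  rwa [Finset.card_product, Finset.card_univ, card_kind, mul_comm] at this

theorem reaches_of_hom_reaches {g : α} {k : Kind} (hg : g ∈ C.gates) {b : α ⊕ ℕ}
    (h : Relation.ReflTransGen (hom C).wire (enc C g k) b) :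
    ∃ h m, Relation.ReflTransGen C.wire g h ∧ b = enc C h m := by
  induction h with
  | refl => exact ⟨g, k, .refl, rfl⟩
  | tail _ w ih =>
    obtain ⟨h, m, r, rfl⟩ := ih
    obtain ⟨h₁, k₁, h₂, k₂, w, e, rfl⟩ := w
    have hh : h ∈ C.gates := by
      cases r with
      | refl => exact hg
      | tail _ w => exact C.mem_right w
    obtain ⟨rfl, rfl⟩ := enc_inj hh w.mem.1 e
    refine ⟨h₂, k₂, ?_, rfl⟩
    rcases w.wire_or_eq with w | ⟨rfl, -⟩
    exacts [r.tail w, r]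

theorem reaches_of_hom_reaches_enc {g h : α} {k m : Kind} (hg : g ∈ C.gates) (hh : h ∈ C.gates)
    (r : Relation.ReflTransGen (hom C).wire (enc C g k) (enc C h m)) :
    Relation.ReflTransGen C.wire g h := by
  obtain ⟨h', m', r', e⟩ := reaches_of_hom_reaches hg r
  have hh' : h' ∈ C.gates := by
    cases r' with
    | refl => exact hg
    | tail _ w => exact C.mem_right w
  rwa [(enc_inj hh hh' e).1]

variable (C) in
theorem depSize_hom : depSize (hom C) ≤ 5 * depSize C := by
  refine Finset.sup_le fun b hb => ?_
  obtain ⟨g, hg, k, rfl⟩ := mem_encGates.1 hb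
  have hfin := deltaSet_finite hg
  have hsub : deltaSet (hom C) (enc C g k) ⊆
      (fun p : α × Kind => enc C p.1 p.2) '' (deltaSet C g ×ˢ Set.univ) := by
    intro b hb
    obtain ⟨h, m, r, rfl⟩ := reaches_of_hom_reaches hg hb
    exact ⟨(h, m), ⟨r, trivial⟩, rfl⟩
  have hfin' := hfin.prod (Set.finite_univ (α := Kind))
  calc (deltaSet (hom C) (enc C g k)).ncard
      ≤ (deltaSet C g ×ˢ (Set.univ : Set Kind)).ncard :=
        (Set.ncard_le_ncard hsub (hfin'.image _)).trans (Set.ncard_image_le hfin')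
    _ = 5 * (deltaSet C g).ncard := by
        rw [Set.ncard_prod, Set.ncard_univ, Nat.card_eq_fintype_card, card_kind, mul_comm]
    _ ≤ 5 * depSize C :=
        Nat.mul_le_mul_left 5 (Finset.le_sup (f := fun g => (deltaSet C g).ncard) hg)

theorem fanIn_le_of_subset_image {g : α} (hg : g ∈ C.gates) {b : α ⊕ ℕ} (f : α → α ⊕ ℕ)
    (h : ∀ a, (hom C).wire a b → ∃ g', C.wire g' g ∧ a = f g') :
    fanIn (hom C) b ≤ maxFanIn C := by
  have hfin : {g' | C.wire g' g}.Finite :=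
    C.gates.finite_toSet.subset fun g' w => C.mem_left w
  have hsub : {a | (hom C).wire a b} ⊆ f '' {g' | C.wire g' g} := by
    intro a w
    obtain ⟨g', w', rfl⟩ := h a w
    exact ⟨g', w', rfl⟩
  exact ((Set.ncard_le_ncard hsub (hfin.image f)).trans (Set.ncard_image_le hfin)).trans
    (Finset.le_sup (f := fanIn C) hg)

theorem fanIn_eq_zero {b : α ⊕ ℕ} (h : ∀ a, ¬ (hom C).wire a b) : fanIn (hom C) b = 0 := by
  simp [fanIn, h]

theorem fanIn_le_three {b x y z : α ⊕ ℕ}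
    (h : ∀ a, (hom C).wire a b → a = x ∨ a = y ∨ a = z) : fanIn (hom C) b ≤ 3 := by
  classical
  have hsub : {a | (hom C).wire a b} ⊆ (({x, y, z} : Finset (α ⊕ ℕ)) : Set (α ⊕ ℕ)) := by
    intro a w
    simpa using h a w
  exact (Set.ncard_le_ncard hsub (Finset.finite_toSet _)).trans
    ((Set.ncard_coe_finset _).trans_le Finset.card_le_three)

variable (C) in
theorem maxFanIn_hom : maxFanIn (hom C) ≤ max 3 (maxFanIn C) := by
  refine Finset.sup_le fun b hb => ?_
  obtain ⟨g, hg, k, rfl⟩ := mem_encGates.1 hb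
  rw [le_max_iff]
  cases k with
  | pos =>
    by_cases hp : C.τ g = .prod
    · exact .inl (fanIn_le_three fun a => (hom_wire_pos_of_prod hg hp).1)
    · exact .inr (fanIn_le_of_subset_image hg _ fun a => (hom_wire_pos hg hp).1)
  | emp => exact .inr (fanIn_le_of_subset_image hg _ fun a => (hom_wire_emp hg).1)
  | mul =>
    by_cases H : HasFactors C g
    · exact .inr (fanIn_le_of_subset_image hg _ fun a => (hom_wire_mul hg H.type_eq).1)
    · rw [fanIn_eq_zero (not_hom_wire_of_not_hasFactors hg H (by simp) (by simp))]
      simp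
  | left =>
    by_cases H : HasFactors C g
    · exact .inl (fanIn_le_three (z := enc C g .emp) fun a w =>
        ((hom_wire_left H).1 w).imp_right .inl)
    · rw [fanIn_eq_zero (not_hom_wire_of_not_hasFactors hg H (by simp) (by simp))]
      simp
  | right =>
    by_cases H : HasFactors C g
    · exact .inl (fanIn_le_three (z := enc C g .emp) fun a w =>
        ((hom_wire_right H).1 w).imp_right .inl)
    · rw [fanIn_eq_zero (not_hom_wire_of_not_hasFactors hg H (by simp) (by simp))]
      simp

theorem type_eq_prod {g : α} {k : Kind} (h : type C g k = .prod) : k = .mul ∧ HasFactors C g := by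
  cases k <;> unfold type at h <;> dsimp only at h <;> split_ifs at h with h'
  · exact absurd h h'
  · exact ⟨rfl, h'⟩

theorem decomposable_hom (hC : decomposable C) : decomposable (hom C) := by
  intro b hb hτ b₁ b₂ w₁ w₂ hne v hv ⟨r₁, r₂⟩
  obtain ⟨h, hh, m, rfl⟩ := mem_encGates.1 hb
  rw [hom_τ hh] at hτ
  obtain ⟨rfl, H⟩ := type_eq_prod hτ
  obtain ⟨g₁, w₁', rfl⟩ := (hom_wire_mul hh H.type_eq).1 w₁
  obtain ⟨g₂, w₂', rfl⟩ := (hom_wire_mul hh H.type_eq).1 w₂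
  have hv_mem : v ∈ (hom C).gates := by
    cases r₁ using Relation.ReflTransGen.head_induction_on with
    | refl => exact enc_mem_encGates (C.mem_left w₁') _
    | head w _ => exact (hom C).mem_left w
  obtain ⟨x, hx, k, rfl⟩ := mem_encGates.1 hv_mem
  rw [hom_τ hx] at hv
  obtain ⟨rfl, hx'⟩ := type_eq_var (.inl rfl) hv
  exact hC h hh H.type_eq g₁ g₂ w₁' w₂' (fun e => hne (e ▸ rfl)) x hx'
    ⟨reaches_of_hom_reaches_enc hx (C.mem_left w₁') r₁,
      reaches_of_hom_reaches_enc hx (C.mem_left w₂') r₂⟩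

/-- The supports of the assignments of the two factors of a ×-gate are disjoint. -/
theorem disjoint_of_mem_factors (hC : decomposable C) {h : α} (H : HasFactors C h)
    {A₁ A₂ : Set (α ⊕ ℕ)} (h₁ : A₁ ∈ sval (hom C) ν (enc C (factors C h).1 .pos))
    (h₂ : A₂ ∈ sval (hom C) ν (enc C (factors C h).2 .pos)) : Disjoint A₁ A₂ := by
  obtain ⟨a₁, h₁', -, rfl⟩ := (mem_sval_hom_pos _ (C.mem_left H.wire_fst) _).1 h₁
  obtain ⟨a₂, h₂', -, rfl⟩ := (mem_sval_hom_pos _ (C.mem_left H.wire_snd) _).1 h₂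
  rw [Set.disjoint_image_iff Sum.inl_injective, Set.disjoint_left]
  intro v v₁ v₂
  obtain ⟨hv, r₁⟩ := reaches_of_mem_sval _ a₁ h₁' v v₁
  exact hC h (C.mem_right H.wire_fst) H.type_eq _ _ H.wire_fst H.wire_snd H.ne v hv
    ⟨r₁, (reaches_of_mem_sval _ a₂ h₂' v v₂).2⟩

theorem disjoint_left_right (hC : decomposable C) {h : α} (H : HasFactors C h) :
    Disjoint (sval (hom C) ν (enc C h .left)) (sval (hom C) ν (enc C h .right)) := by
  rw [Set.disjoint_left]
  intro A hl hr
  have h₁ := ((mem_sval_hom_left H).1 hl).1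
  have h₂ := ((mem_sval_hom_right H).1 hr).1
  exact (nonempty_of_mem_sval_hom_pos (C.mem_left H.wire_fst) h₁).ne_empty
    (disjoint_self.1 (disjoint_of_mem_factors hC H h₁ h₂))

theorem disjoint_mul_left (hC : decomposable C) {h : α} (H : HasFactors C h) :
    Disjoint (sval (hom C) ν (enc C h .mul)) (sval (hom C) ν (enc C h .left)) := by
  rw [Set.disjoint_left]
  intro A hm hl
  obtain ⟨A₁, -, A₂, h₂, rfl⟩ := (mem_sval_prod (isFactors_mul H)).1 hm
  have h₁ := ((mem_sval_hom_left H).1 hl).1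
  exact (nonempty_of_mem_sval_hom_pos (C.mem_left H.wire_snd) h₂).ne_empty
    (disjoint_self.1 ((disjoint_of_mem_factors hC H h₁ h₂).mono_left Set.subset_union_right))

theorem disjoint_mul_right (hC : decomposable C) {h : α} (H : HasFactors C h) :
    Disjoint (sval (hom C) ν (enc C h .mul)) (sval (hom C) ν (enc C h .right)) := by
  rw [Set.disjoint_left]
  intro A hm hr
  obtain ⟨A₁, h₁, A₂, -, rfl⟩ := (mem_sval_prod (isFactors_mul H)).1 hm
  have h₂ := ((mem_sval_hom_right H).1 hr).1
  exact (nonempty_of_mem_sval_hom_pos (C.mem_left H.wire_fst) h₁).ne_empty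
    (disjoint_self.1 ((disjoint_of_mem_factors hC H h₁ h₂).mono_right Set.subset_union_left))

theorem deterministic_hom (hC : isDDNNF C) : deterministic (hom C) := by
  intro ν b hb hτ b₁ b₂ w₁ w₂ hne
  obtain ⟨h, hh, m, rfl⟩ := mem_encGates.1 hb
  by_cases hm : m = .pos
  · subst hm
    by_cases hp : C.τ h = .prod
    · by_cases H : HasFactors C h
      · have lr := disjoint_left_right (ν := ν) hC.1 H
        have ml := disjoint_mul_left (ν := ν) hC.1 H
        have mr := disjoint_mul_right (ν := ν) hC.1 H
        rcases (hom_wire_pos_of_prod hh hp).1 w₁ with rfl | rfl | rfl <;>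
          rcases (hom_wire_pos_of_prod hh hp).1 w₂ with rfl | rfl | rfl
        exacts [absurd rfl hne, ml, mr, ml.symm, absurd rfl hne, lr, mr.symm, lr.symm,
          absurd rfl hne]
      · rcases (hom_wire_pos_of_prod hh hp).1 w₁ with rfl | rfl | rfl <;>
          simp [sval_hom_eq_empty hh H]
    · rw [hom_τ hh, type_pos hp] at hτ
      obtain ⟨g₁, w₁', rfl⟩ := (hom_wire_pos hh hp).1 w₁
      obtain ⟨g₂, w₂', rfl⟩ := (hom_wire_pos hh hp).1 w₂
      rw [Set.disjoint_left]
      intro A h₁ h₂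
      obtain ⟨a₁, h₁', -, rfl⟩ := (mem_sval_hom_pos _ (C.mem_left w₁') _).1 h₁
      obtain ⟨a₂, h₂', -, e⟩ := (mem_sval_hom_pos _ (C.mem_left w₂') _).1 h₂
      obtain rfl := Sum.inl_injective.image_injective e
      exact Set.disjoint_left.1
        (hC.2 _ h hh hτ g₁ g₂ w₁' w₂' fun e => hne (e ▸ rfl)) h₁' h₂'
  · by_cases he : m = .emp
    · subst he
      have := isBoolean_hom_emp hh
      simp [hτ, GateType.isBoolean] at this
    · by_cases H : HasFactors C h
      · rw [hom_τ hh] at hτ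
        cases m <;> simp [type, H] at hτ hm he
      · exact absurd w₁ (not_hom_wire_of_not_hasFactors hh H hm he _)

/-- A pure wire leaving a gate `pos` comes from a pure wire `(g, h)`, and the pair `(g, h)`
determines where it leads. -/
theorem exists_pureWire_of_hom {g : α} (hg : g ∈ C.gates) {b : α ⊕ ℕ}
    (hw : pureWire (hom C) ν (enc C g .pos) b) :
    ∃ h m, pureWire C (ν ∘ Sum.inl) g h ∧ b = enc C h m ∧
      (m = .pos ∧ C.τ h ≠ .prod ∨
        HasFactors C h ∧ (m = .left ∧ g = (factors C h).1 ∨ m = .right ∧ g = (factors C h).2)) := by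
  obtain ⟨⟨g', k, h, m, w, e, rfl⟩, hs, hpure⟩ := hw
  obtain ⟨rfl, rfl⟩ := enc_inj hg w.mem.1 e
  rw [hom_τ hg, isBoolean_type_pos] at hs
  rw [hom_τ w.mem.2] at hpure
  refine ⟨h, m, ?_, rfl, ?_⟩
  · cases w with
    | pos w hp =>
      rw [type_pos hp] at hpure
      refine ⟨w, hs, ?_⟩
      rcases hpure with hu | ⟨hb, hall⟩ | ⟨hp', -⟩
      · exact .inl hu
      · refine .inr (.inl ⟨hb, fun g'' w'' hb'' => ?_⟩)
        rw [← bval_hom_pos g'' (C.mem_left w'') hb'']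
        refine hall _ (encWire_of_wire (.pos w'' hp)) ?_
        rwa [hom_τ (C.mem_left w''), isBoolean_type_pos]
      · exact absurd hp' hp
    | emp_bool _ hb => exact absurd hb hs
    | mul w hp =>
      have H := hasFactors hp w
      simp only [type, H, if_true, reduceCtorEq, false_and, false_or, true_and] at hpure
      obtain ⟨x, wx, -, hx⟩ := hpure
      exact absurd (nonempty_of_mem_sval_hom ((hom C).mem_left wx) hx) Set.not_nonempty_empty
    | left_pos H =>
      simp only [type, H, if_true, reduceCtorEq, false_and, or_false, false_or, true_and] at hpure
      refine ⟨H.wire_fst, hs, .inr (.inr ⟨H.type_eq, _, H.wire_snd, H.ne.symm, ?_⟩)⟩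
      rw [← bval_hom_emp _ (C.mem_left H.wire_snd) (H.not_isBoolean H.wire_snd)]
      exact hpure _ (encWire_of_wire (.left_emp H)) (isBoolean_hom_emp (C.mem_left H.wire_snd))
    | right_pos H =>
      simp only [type, H, if_true, reduceCtorEq, false_and, or_false, false_or, true_and] at hpure
      refine ⟨H.wire_snd, hs, .inr (.inr ⟨H.type_eq, _, H.wire_fst, H.ne, ?_⟩)⟩
      rw [← bval_hom_emp _ (C.mem_left H.wire_fst) (H.not_isBoolean H.wire_fst)]
      exact hpure _ (encWire_of_wire (.right_emp H)) (isBoolean_hom_emp (C.mem_left H.wire_fst))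
  · cases w with
    | pos w hp => exact .inl ⟨rfl, hp⟩
    | emp_bool _ hb => exact absurd hb hs
    | mul w hp =>
      have H := hasFactors hp w
      simp only [type, H, if_true, reduceCtorEq, false_and, false_or, true_and] at hpure
      obtain ⟨x, wx, -, hx⟩ := hpure
      exact absurd (nonempty_of_mem_sval_hom ((hom C).mem_left wx) hx) Set.not_nonempty_empty
    | left_pos H => exact .inr ⟨H, .inl ⟨rfl, rfl⟩⟩
    | right_pos H => exact .inr ⟨H, .inr ⟨rfl, rfl⟩⟩

theorem eq_of_hom_wire {g : α} {k : Kind} {b : α ⊕ ℕ} (hg : g ∈ C.gates) (hp : k ≠ .pos)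
    (he : k ≠ .emp) (w : (hom C).wire (enc C g k) b) : b = enc C g .pos := by
  obtain ⟨g', k', h, m, w, e, rfl⟩ := w
  obtain ⟨rfl, rfl⟩ := enc_inj hg w.mem.1 e
  cases w <;> first | rfl | exact absurd rfl hp | exact absurd rfl he

theorem upwardsDeterministic_hom (hC : upwardsDeterministic C) : upwardsDeterministic (hom C) := by
  intro ν b b₁ b₂ w₁ w₂
  obtain ⟨g, hg, k, rfl⟩ := mem_encGates.1 ((hom C).mem_left w₁.1)
  by_cases hp : k = .pos
  · subst hp
    obtain ⟨h, m₁, p₁, rfl, hm₁⟩ := exists_pureWire_of_hom hg w₁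
    obtain ⟨h', m₂, p₂, rfl, hm₂⟩ := exists_pureWire_of_hom hg w₂
    obtain rfl := hC _ g h h' p₁ p₂
    congr 1
    rcases hm₁ with ⟨rfl, n₁⟩ | ⟨H, hm₁⟩ <;> rcases hm₂ with ⟨rfl, n₂⟩ | ⟨H', hm₂⟩
    · rfl
    · exact absurd H'.type_eq n₁
    · exact absurd H.type_eq n₂
    · rcases hm₁ with ⟨rfl, e₁⟩ | ⟨rfl, e₁⟩ <;> rcases hm₂ with ⟨rfl, e₂⟩ | ⟨rfl, e₂⟩
      · rfl
      · exact absurd (e₁.symm.trans e₂) H.ne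
      · exact absurd (e₂.symm.trans e₁) H.ne
      · rfl
  · by_cases he : k = .emp
    · subst he
      exact absurd (isBoolean_hom_emp hg) w₁.2.1
    · rw [eq_of_hom_wire hg hp he w₁.1, eq_of_hom_wire hg hp he w₂.1]

end Homogenization

/-- homogenization lemma: there is a constant `c` such that every hybrid
circuit `C` admits a homogenized hybrid circuit `C'` (over the gate type `α ⊕ ℕ`, the
gates of `C` being embedded via `Sum.inl`) with a secondary output `g₁` that is equivalent
to `C`: same set-valued variables, same Boolean variables, and for every valuation the set
captured by `C'` (the set captured by its output gate, together with the empty assignment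
when the secondary output evaluates to 1) equals the set captured by `C`. Moreover `C'` has
at most `c` times as many gates as `C`, is a d-DNNF whenever `C` is, is
upwards-deterministic whenever `C` is, has maximal fan-in at most `max 3 (maxFanIn C)`,
and has dependency size `Δ(C') ≤ c * Δ(C)`. -/
theorem homogenization :
    ∃ c : ℕ, 0 < c ∧ ∀ (α : Type) (C : HybridCircuit α),
      ∃ (C' : HybridCircuit (α ⊕ ℕ)) (g₁ : α ⊕ ℕ),
        g₁ ∈ C'.gates ∧ (C'.τ g₁).isBoolean ∧
        homogenized C' ∧
        {g | g ∈ C'.gates ∧ C'.τ g = GateType.svar} =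
          Sum.inl '' {g | g ∈ C.gates ∧ C.τ g = GateType.svar} ∧
        {g | g ∈ C'.gates ∧ C'.τ g = GateType.bvar} =
          Sum.inl '' {g | g ∈ C.gates ∧ C.τ g = GateType.bvar} ∧
        (∀ ν : α ⊕ ℕ → Bool,
          sval C' ν C'.out ∪
              (if bval C' ν g₁ = true then {(∅ : Set (α ⊕ ℕ))} else ∅) =
            (fun A : Set α => Sum.inl '' A) '' sval C (ν ∘ Sum.inl) C.out) ∧
        C'.gates.card ≤ c * C.gates.card ∧
        (isDDNNF C → isDDNNF C') ∧
        (upwardsDeterministic C → upwardsDeterministic C') ∧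
        maxFanIn C' ≤ max 3 (maxFanIn C) ∧
        depSize C' ≤ c * depSize C := by
  refine ⟨5, by simp, fun α C => ?_⟩
  open Homogenization in
  exact ⟨hom C, enc C C.out .emp, enc_mem_encGates C.out_mem _, isBoolean_hom_emp C.out_mem,
    homogenized_hom C, hom_var C (.inl rfl), hom_var C (.inr rfl), sval_hom_out C,
    card_hom_gates C, fun hC => ⟨decomposable_hom hC.1, deterministic_hom hC⟩,
    upwardsDeterministic_hom, maxFanIn_hom C, depSize_hom C⟩

end MSOEnum
end

section
/- Let K be a commutative semiring, let C be a hybrid circuit that is a d-DNNF, let ρ : C_svar → K, and let ν be a valuation of C. Define a K-valued evaluation ω'_ν on the set-valued gates of C bottom-up: ω'_ν(g) := ρ(g) for svar-gates g; ω'_ν(g) := 1 for ×-gates g with no inputs; ω'_ν(g) := ω'_ν(g₁) · ω'_ν(g₂) for ×-gates g with inputs g₁, g₂; for a ⊠-gate g with set-valued input g' and Boolean input g'', ω'_ν(g) := ω'_ν(g') if ⟨g''⟩_ν = 1 and ω'_ν(g) := 0 otherwise; and ω'_ν(g) := Σᵢ ω'_ν(gᵢ) for ∪-gates g with inputs g₁,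 …, gₙ (the empty sum being 0). Then for every set-valued gate g of C: ω'_ν(g) = Σ_{A ∈ ⟦g⟧_ν} ∏_{x ∈ A} ρ(x), where the sum ranges over the finite set ⟦g⟧_ν of assignments and each product over the finite assignment A (the empty product being 1 and the empty sum 0). -/
namespace MSOEnum

theorem sval_of_svar (C : HybridCircuit α) (ν : α → Bool) {g : α}
    (hg : C.τ g = GateType.svar) : sval C ν g = {{g}} := by
  rw [sval, WellFounded.fix_eq, hg]

theorem sval_of_union (C : HybridCircuit α) (ν : α → Bool) {g : α}
    (hg : C.τ g = GateType.union) :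
    sval C ν g = ⋃ g' ∈ {g' | C.wire g' g}, sval C ν g' := by
  rw [sval, WellFounded.fix_eq, hg]
  ext a
  simp

theorem sval_of_prod_of_no_input (C : HybridCircuit α) (ν : α → Bool) {g : α}
    (hg : C.τ g = GateType.prod) (h : ∀ g', ¬ C.wire g' g) : sval C ν g = {∅} := by
  rw [sval, WellFounded.fix_eq, hg]
  simp [h]

theorem sval_of_prod (C : HybridCircuit α) (ν : α → Bool) {g g₁ g₂ : α}
    (hg : C.τ g = GateType.prod) (hne : g₁ ≠ g₂) (h₁ : C.wire g₁ g) (h₂ : C.wire g₂ g)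
    (h : ∀ g', C.wire g' g → g' = g₁ ∨ g' = g₂) :
    sval C ν g = (fun p : Set α × Set α => p.1 ∪ p.2) '' (sval C ν g₁ ×ˢ sval C ν g₂) := by
  have hin : ¬ ∀ g', ¬ C.wire g' g := fun h' => h' g₁ h₁
  rw [sval, WellFounded.fix_eq, hg]
  simp only [if_neg hin]
  ext a
  simp only [Set.mem_ofPred_eq, Set.mem_image, Set.mem_prod, Prod.exists]
  constructor
  · rintro ⟨k₁, k₂, hk₁, hk₂, hk, a₁, ha₁, a₂, ha₂, rfl⟩
    rcases h k₁ hk₁ with rfl | rfl <;> rcases h k₂ hk₂ with rfl | rfl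
    · exact absurd rfl hk
    · exact ⟨a₁, a₂, ⟨ha₁, ha₂⟩, rfl⟩
    · exact ⟨a₂, a₁, ⟨ha₂, ha₁⟩, Set.union_comm _ _⟩
    · exact absurd rfl hk
  · rintro ⟨a₁, a₂, ⟨ha₁, ha₂⟩, rfl⟩
    exact ⟨g₁, g₂, h₁, h₂, hne, a₁, ha₁, a₂, ha₂, rfl⟩

theorem sval_of_box (C : HybridCircuit α) (ν : α → Bool) {g gs gb : α}
    (hg : C.τ g = GateType.box) (hs : ¬ (C.τ gs).isBoolean) (hb : (C.τ gb).isBoolean)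
    (hgs : C.wire gs g) (hgb : C.wire gb g) (h : ∀ g', C.wire g' g → g' = gs ∨ g' = gb) :
    sval C ν g = if bval C ν gb = true then sval C ν gs else ∅ := by
  rw [sval, WellFounded.fix_eq, hg]
  ext a
  simp only [Set.mem_ofPred_eq]
  constructor
  · rintro ⟨⟨g', hg', hs', ha⟩, hbool⟩
    rw [if_pos (hbool gb hgb hb)]
    rcases h g' hg' with rfl | rfl
    · exact ha
    · exact absurd hb hs'
  · intro ha
    split_ifs at ha with hν
    · refine ⟨⟨gs, hgs, hs, ha⟩, fun g' hg' hb' => ?_⟩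
      rcases h g' hg' with rfl | rfl
      · exact absurd hb' hs
      · exact hν
    · exact ha.elim

/-- Captured assignments consist of svar-gates having a directed path to the capturing gate. -/
theorem svar_and_path_of_mem_sval (C : HybridCircuit α) (ν : α → Bool) (g : α) :
    g ∈ C.gates → ∀ a ∈ sval C ν g, ∀ x ∈ a,
      C.τ x = GateType.svar ∧ Relation.ReflTransGen C.wire x g := by
  induction g using C.acyclic.induction with
  | _ g ih =>
  have step : ∀ g', C.wire g' g → ∀ a ∈ sval C ν g', ∀ x ∈ a,
      C.τ x = GateType.svar ∧ Relation.ReflTransGen C.wire x g := fun g' hw a ha x hx =>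
    (ih g' hw (C.wire_mem _ _ hw).1 a ha x hx).imp_right fun hp => hp.tail hw
  intro hmem a ha x hx
  cases hg : C.τ g with
  | svar =>
    rw [sval_of_svar C ν hg] at ha
    obtain rfl := ha
    obtain rfl := hx
    exact ⟨hg, .refl⟩
  | union =>
    rw [sval_of_union C ν hg] at ha
    obtain ⟨g', hw, ha'⟩ := Set.mem_iUnion₂.1 ha
    exact step g' hw a ha' x hx
  | prod =>
    rcases C.prod_inputs g hmem hg with h | ⟨g₁, g₂, hne, h₁, h₂, h⟩
    · rw [sval_of_prod_of_no_input C ν hg h] at ha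
      obtain rfl := ha
      exact hx.elim
    · rw [sval_of_prod C ν hg hne h₁ h₂ h] at ha
      obtain ⟨⟨a₁, a₂⟩, ⟨ha₁, ha₂⟩, rfl⟩ := ha
      rcases hx with hx | hx
      · exact step g₁ h₁ a₁ ha₁ x hx
      · exact step g₂ h₂ a₂ ha₂ x hx
  | box =>
    obtain ⟨gs, gb, hs, hb, hgs, hgb, h⟩ := C.box_inputs g hmem hg
    rw [sval_of_box C ν hg hs hb hgs hgb h] at ha
    split_ifs at ha
    · exact step gs hgs a ha x hx
    · exact ha.elim
  | _ =>
    rw [sval, WellFounded.fix_eq, hg] at ha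
    exact ha.elim

theorem mem_gates_of_reflTransGen (C : HybridCircuit α) {x g : α} (hg : g ∈ C.gates)
    (h : Relation.ReflTransGen C.wire x g) : x ∈ C.gates := by
  rcases h.cases_head with rfl | ⟨y, hy, -⟩
  · exact hg
  · exact (C.wire_mem _ _ hy).1

theorem subset_gates_of_mem_sval (C : HybridCircuit α) (ν : α → Bool) {g : α}
    (hg : g ∈ C.gates) {a : Set α} (ha : a ∈ sval C ν g) : a ⊆ C.gates := fun x hx =>
  mem_gates_of_reflTransGen C hg (svar_and_path_of_mem_sval C ν g hg a ha x hx).2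

theorem finite_of_mem_sval (C : HybridCircuit α) (ν : α → Bool) {g : α}
    (hg : g ∈ C.gates) {a : Set α} (ha : a ∈ sval C ν g) : a.Finite :=
  C.gates.finite_toSet.subset (subset_gates_of_mem_sval C ν hg ha)

theorem finite_sval (C : HybridCircuit α) (ν : α → Bool) {g : α} (hg : g ∈ C.gates) :
    (sval C ν g).Finite :=
  C.gates.finite_toSet.finite_subsets.subset fun _ ha => subset_gates_of_mem_sval C ν hg ha

/-- If every member of `S` is disjoint from every member of `T`, then the generating sum of
`{a ∪ b | a ∈ S, b ∈ T}` is the product of those of `S` and `T`. -/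
theorem finsum_mem_image_union_finprod {K : Type*} [CommSemiring K] (ρ : α → K)
    {S T : Set (Set α)} (hS : S.Finite) (hT : T.Finite) (hSf : ∀ a ∈ S, a.Finite)
    (hTf : ∀ b ∈ T, b.Finite) (hST : ∀ a ∈ S, ∀ b ∈ T, Disjoint a b) :
    ∑ᶠ A ∈ (fun p : Set α × Set α => p.1 ∪ p.2) '' (S ×ˢ T), ∏ᶠ x ∈ A, ρ x =
      (∑ᶠ A ∈ S, ∏ᶠ x ∈ A, ρ x) * ∑ᶠ A ∈ T, ∏ᶠ x ∈ A, ρ x := by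
  have hinj : Set.InjOn (fun p : Set α × Set α => p.1 ∪ p.2) (S ×ˢ T) := by
    rintro ⟨a, b⟩ ⟨ha, hb⟩ ⟨c, d⟩ ⟨hc, hd⟩ h
    have hab := Set.disjoint_left.1 (hST a ha b hb)
    have had := Set.disjoint_left.1 (hST a ha d hd)
    have hcb := Set.disjoint_left.1 (hST c hc b hb)
    have hcd := Set.disjoint_left.1 (hST c hc d hd)
    have hx : ∀ x, x ∈ a ∨ x ∈ b ↔ x ∈ c ∨ x ∈ d := fun x => Set.ext_iff.1 h x
    refine Prod.ext (Set.ext fun x => ?_) (Set.ext fun x => ?_) <;>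
      have := hx x <;> have := @hab x <;> have := @had x <;> have := @hcb x <;>
      have := @hcd x <;> tauto
  rw [finsum_mem_image hinj]
  lift S to Finset (Set α) using hS
  lift T to Finset (Set α) using hT
  rw [← Finset.coe_product, finsum_mem_coe_finset, finsum_mem_coe_finset, finsum_mem_coe_finset,
    Finset.sum_mul_sum, Finset.sum_product]
  exact Finset.sum_congr rfl fun a ha => Finset.sum_congr rfl fun b hb =>
    finprod_mem_union (hST a ha b hb) (hSf a ha) (hTf b hb)

/-- let `K` be a commutative semiring, `C` a hybrid circuit that is a d-DNNF,
`ρ : C_svar → K`, and `ν` a valuation of `C`. If `w` is the `K`-valued evaluation `ω'_ν`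
defined bottom-up on the set-valued gates by the recurrences (`ρ(g)` on svar-gates, `1` on
×-gates with no inputs, products on ×-gates with two inputs, gating by the Boolean input on
⊠-gates, and sums over inputs on ∪-gates), then on every set-valued gate `g` of `C`,
`w g = Σ_{A ∈ ⟦g⟧_ν} Π_{x ∈ A} ρ x`. -/
theorem semiring_evaluation {α : Type} {K : Type} [CommSemiring K]
    (C : HybridCircuit α) (hC : isDDNNF C) (ρ : α → K) (ν : α → Bool) (w : α → K)
    (hsvar : ∀ g ∈ C.gates, C.τ g = GateType.svar → w g = ρ g)
    (hprod0 : ∀ g ∈ C.gates, C.τ g = GateType.prod → (∀ g', ¬ C.wire g' g) → w g = 1)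
    (hprod2 : ∀ g ∈ C.gates, C.τ g = GateType.prod →
      ∀ g₁ g₂, C.wire g₁ g → C.wire g₂ g → g₁ ≠ g₂ → w g = w g₁ * w g₂)
    (hbox : ∀ g ∈ C.gates, C.τ g = GateType.box →
      ∀ gs gb, C.wire gs g → C.wire gb g → ¬ (C.τ gs).isBoolean → (C.τ gb).isBoolean →
        w g = if bval C ν gb = true then w gs else 0)
    (hunion : ∀ g ∈ C.gates, C.τ g = GateType.union →
      w g = ∑ᶠ g' ∈ {g' | C.wire g' g}, w g') :
    ∀ g ∈ C.gates, ¬ (C.τ g).isBoolean →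
      w g = ∑ᶠ A ∈ sval C ν g, ∏ᶠ x ∈ A, ρ x := by
  intro g
  induction g using C.acyclic.induction with
  | _ g ih =>
  intro hmem hset
  have ih' : ∀ g', C.wire g' g → ¬ (C.τ g').isBoolean →
      w g' = ∑ᶠ A ∈ sval C ν g', ∏ᶠ x ∈ A, ρ x := fun g' hw =>
    ih g' hw (C.wire_mem _ _ hw).1
  cases hg : C.τ g with
  | svar => rw [hsvar g hmem hg, sval_of_svar C ν hg, finsum_mem_singleton, finprod_mem_singleton]
  | union =>
    have hfin : {g' | C.wire g' g}.Finite :=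
      C.gates.finite_toSet.subset fun g' hw => (C.wire_mem g' g hw).1
    have hdisj : {g' | C.wire g' g}.PairwiseDisjoint (sval C ν) := fun g₁ h₁ g₂ h₂ hne =>
      hC.2 ν g hmem hg g₁ g₂ h₁ h₂ hne
    rw [hunion g hmem hg, sval_of_union C ν hg, finsum_mem_biUnion hdisj hfin fun g' hw =>
      finite_sval C ν (C.wire_mem g' g hw).1]
    exact finsum_mem_congr rfl fun g' hw => ih' g' hw (C.setGate_inputs g (.inl hg) g' hw)
  | prod =>
    rcases C.prod_inputs g hmem hg with h | ⟨g₁, g₂, hne, h₁, h₂, h⟩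
    · rw [hprod0 g hmem hg h, sval_of_prod_of_no_input C ν hg h, finsum_mem_singleton,
        finprod_mem_empty]
    · have hm₁ := (C.wire_mem _ _ h₁).1
      have hm₂ := (C.wire_mem _ _ h₂).1
      rw [hprod2 g hmem hg g₁ g₂ h₁ h₂ hne, sval_of_prod C ν hg hne h₁ h₂ h,
        finsum_mem_image_union_finprod ρ (finite_sval C ν hm₁) (finite_sval C ν hm₂)
          (fun _ => finite_of_mem_sval C ν hm₁) (fun _ => finite_of_mem_sval C ν hm₂),
        ih' g₁ h₁ (C.setGate_inputs g (.inr hg) g₁ h₁),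
        ih' g₂ h₂ (C.setGate_inputs g (.inr hg) g₂ h₂)]
      refine fun a ha b hb => Set.disjoint_left.2 fun x hxa hxb => ?_
      obtain ⟨hx, hp₁⟩ := svar_and_path_of_mem_sval C ν g₁ hm₁ a ha x hxa
      exact hC.1 g hmem hg g₁ g₂ h₁ h₂ hne x hx
        ⟨hp₁, (svar_and_path_of_mem_sval C ν g₂ hm₂ b hb x hxb).2⟩
  | box =>
    obtain ⟨gs, gb, hs, hb, hgs, hgb, h⟩ := C.box_inputs g hmem hg
    rw [hbox g hmem hg gs gb hgs hgb hs hb, sval_of_box C ν hg hs hb hgs hgb h]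
    split_ifs
    · exact ih' gs hgs hs
    · rw [finsum_mem_empty]
  | _ => exact absurd (by rw [hg]; trivial) hset

end MSOEnum
end
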